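/- Let H be an algebraic k-hypergraph and P a d-dimensional k-template. The following are equivalent: (1) for every M < ω, L(M^d,P) is embeddable into H; (2) L(ℝ^d,P) is embeddable into H; (3) L(ℝ^d,P) is immersible into H. -/

import Mathlib

open Cardinal

universe u v

/-- `f` is one-to-one in each coordinate: if `a` and `b` differ in exactly one
coordinate, then `f a ≠ f b`. -/
def OneToOneEachCoord {d : ℕ} {X C : Type*} (f : (Fin d → X) → C) : Prop :=
  ∀ a b : Fin d → X, (∃ i, a i ≠ b i ∧ ∀ j, j ≠ i → a j = b j) → f a ≠ f b

/-- `Q` is a homomorphic image of the template `P`: there is a surjection of `P`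
onto `Q` preserving coordinate equalities. -/
def IsHomImage {d : ℕ} {α β : Type*} (P : Finset (Fin d → α)) (Q : Finset (Fin d → β)) : Prop :=
  ∃ f : (Fin d → α) → (Fin d → β),
    (∀ x ∈ P, f x ∈ Q) ∧ (∀ y ∈ Q, ∃ x ∈ P, f x = y) ∧
    (∀ x ∈ P, ∀ y ∈ P, ∀ i, x i = y i → f x i = f y i)

/-- The edge set of the template hypergraph `L(X^d, P)`: the edges are the
`k`-element subsets of `X^d` that are homomorphic images of `P`. -/
def LEdges (k : ℕ) {d : ℕ} {α : Type*} (P : Finset (Fin d → α)) (X : Type*) :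
    Set (Finset (Fin d → X)) :=
  {Q | Q.card = k ∧ IsHomImage P Q}

/-- Image of a finset (with classical decidable equality). -/
noncomputable def fimg {V W : Type*} (g : V → W) (e : Finset V) : Finset W :=
  @Finset.image _ _ (Classical.decEq W) g e

/-- `g` is an embedding of the hypergraph with edge set `E₁` into the one with
edge set `E₂`: an injection on vertices mapping every edge to an edge. -/
def IsHGEmbedding {V W : Type*} (E₁ : Set (Finset V)) (E₂ : Set (Finset W)) (g : V → W) : Prop :=
  Function.Injective g ∧ ∀ e ∈ E₁, fimg g e ∈ E₂

def Embeddable {V W : Type*} (E₁ : Set (Finset V)) (E₂ : Set (Finset W)) : Prop :=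
  ∃ g, IsHGEmbedding E₁ E₂ g

/-- The hypergraph with edge set `E` has a coloring with at most `κ` colors
that is not constant on any edge. -/
def ProperlyColorable {V : Type u} (E : Set (Finset V)) (κ : Cardinal.{u}) : Prop :=
  ∃ (C : Type u) (φ : V → C), #C ≤ κ ∧ ∀ e ∈ E, ∃ x ∈ e, ∃ y ∈ e, φ x ≠ φ y

/-- The chromatic number: the least `κ` admitting a proper `κ`-coloring. -/
noncomputable def chromaticNumber {V : Type u} (E : Set (Finset V)) : Cardinal.{u} :=
  sInf {κ | ProperlyColorable E κ}

/-- The edge set of the zero `k`-hypergraph of a `(k,n)`-ary real polynomial: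
the `k`-element subsets of `ℝ^n` admitting an enumeration on which `p` vanishes. -/
def zeroEdges (k n : ℕ) (p : MvPolynomial (Fin k × Fin n) ℝ) : Set (Finset (Fin n → ℝ)) :=
  {s | ∃ a : Fin k → (Fin n → ℝ), Function.Injective a ∧
        fimg a Finset.univ = s ∧ MvPolynomial.eval (fun v => a v.1 v.2) p = 0}

/-- An immersion of `L(X^d, P)` into the `k`-hypergraph with vertices `V` and edges `E`:
a map one-to-one in each coordinate sending every edge on which it is injective
to an edge of the target. -/
def IsImmersion {d : ℕ} {α X V : Type*} (k : ℕ) (P : Finset (Fin d → α))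
    (E : Set (Finset V)) (f : (Fin d → X) → V) : Prop :=
  OneToOneEachCoord f ∧ ∀ Q ∈ LEdges k P X, Set.InjOn f ↑Q → fimg f Q ∈ E

theorem exists_avoiding {ι β : Type*} [Fintype ι] [DecidableEq ι] [Fintype β] (N : ℕ)
    (hN : Fintype.card β < N) (v : β → ι) (bad : β → (ι → Fin N) → Prop)
    (h : ∀ b ω x y, bad b (Function.update ω (v b) x) → bad b (Function.update ω (v b) y) → x = y) :
    ∃ ω, ∀ b, ¬ bad b ω := by
  by_contra! hb
  choose b hb using hb
  have hinj : Function.Injective (fun z : (ι → Fin N) × Fin N =>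
      (b z.1, Function.update z.1 (v (b z.1)) z.2)) := by
    rintro ⟨w₁, x₁⟩ ⟨w₂, x₂⟩ he
    simp only [Prod.mk.injEq] at he
    obtain ⟨h1, h2⟩ := he
    rw [← h1] at h2
    have hx : x₁ = x₂ := by simpa using congrFun h2 (v (b w₁))
    have hb₂ : bad (b w₁) w₂ := h1 ▸ hb w₂
    have hw : w₂ = Function.update w₁ (v (b w₁)) (w₂ (v (b w₁))) := by
      ext1 i
      by_cases hi : i = v (b w₁)
      · subst hi; simp
      · simpa [hi] using (congrFun h2 i).symm
    have h3 : w₁ (v (b w₁)) = w₂ (v (b w₁)) := by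
      refine h (b w₁) w₁ _ _ ?_ (hw ▸ hb₂)
      simpa using hb w₁
    rw [← h3, Function.update_eq_self] at hw
    simp [hx, hw]
  have := Fintype.card_le_of_injective _ hinj
  simp only [Fintype.card_prod, Fintype.card_fun, Fintype.card_fin] at this
  have hp : 0 < N ^ Fintype.card ι := Nat.pow_pos (Nat.zero_lt_of_lt hN)
  nlinarith

theorem exists_generic_grid {d : ℕ} {X C L : Type*} [Finite L] (g : (Fin d → X) → C)
    (hg : OneToOneEachCoord g) (e : Fin d → L → ℕ → X) (he : ∀ i l, Function.Injective (e i l)) :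
    ∃ w : Fin d → L → ℕ, Function.Injective
      (fun a : Fin d → L => g (fun i => e i (a i) (w i (a i)))) := by
  classical
  have := Fintype.ofFinite L
  let B := {z : (Fin d → L) × (Fin d → L) // z.1 ≠ z.2}
  have hB : ∀ z : B, ∃ i, z.1.1 i ≠ z.1.2 i := fun z => Function.ne_iff.1 z.2
  choose i hi using hB
  obtain ⟨w, hw⟩ := exists_avoiding (ι := Fin d × L) (β := B) (Fintype.card B + 1) (Nat.lt_succ_self _)
    (fun z => (i z, z.1.1 (i z)))
    (fun z w => g (fun i => e i (z.1.1 i) (w (i, z.1.1 i))) =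
      g (fun i => e i (z.1.2 i) (w (i, z.1.2 i)))) (by
        intro z w x y h1 h2
        by_contra hxy
        have hz2 : ∀ (t) (j), Function.update w (i z, z.1.1 (i z)) t (j, z.1.2 j) =
            w (j, z.1.2 j) := by
          intro t j
          rw [Function.update_of_ne]
          intro h
          rw [Prod.mk.injEq] at h
          obtain ⟨rfl, h⟩ := h
          exact hi z h.symm
        simp only [hz2] at h1 h2
        refine hg _ _ ⟨i z, ?_, ?_⟩ (h1.trans h2.symm)
        · simpa [(he _ _).eq_iff, Fin.val_inj] using hxy
        · intro j hj
          simp [Function.update_of_ne, hj])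
  refine ⟨fun i l => w (i, l), fun a b hab => ?_⟩
  by_contra hne
  exact hw ⟨(a, b), hne⟩ hab

theorem IsImmersion.embeddable_fin {d k : ℕ} {α V : Type*} {P : Finset (Fin d → α)}
    {E : Set (Finset V)} {f : (Fin d → ℝ) → V} (hf : IsImmersion k P E f) (M : ℕ) :
    Embeddable (LEdges k P (Fin M)) E := by
  classical
  obtain ⟨w, hw⟩ := exists_generic_grid (L := Fin M) f hf.1 (fun _ _ m => (m : ℝ))
    (fun _ _ => Nat.cast_injective)
  set G : (Fin d → Fin M) → (Fin d → ℝ) := fun a i => (w i (a i) : ℝ) with hG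
  have hw' : Function.Injective (f ∘ G) := hw
  refine ⟨f ∘ G, hw', ?_⟩
  rintro Q ⟨hQ, φ, h1, h2, h3⟩
  have := hf.2 (Q.image G) ⟨by rw [Finset.card_image_of_injective _ hw'.of_comp, hQ], G ∘ φ,
    fun x hx => Finset.mem_image_of_mem _ (h1 x hx), ?_, ?_⟩ ?_
  · convert this using 1
    unfold fimg
    ext
    simp
  · intro y hy
    obtain ⟨z, hz, rfl⟩ := Finset.mem_image.1 hy
    obtain ⟨x, hx, rfl⟩ := h2 z hz
    exact ⟨x, hx, rfl⟩
  · intro x hx y hy i hi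
    simp [hG, h3 x hx y hy i hi]
  · intro x hx y hy hxy
    simp only [Finset.coe_image, Set.mem_image] at hx hy
    obtain ⟨x, hx, rfl⟩ := hx
    obtain ⟨y, hy, rfl⟩ := hy
    rw [hw' hxy]

theorem exists_polarized (d : ℕ) : ∃ X : Type, ∀ c : (Fin d → X) → ℕ,
    ∃ ι : Fin d → ℕ → X, (∀ i, Function.Injective (ι i)) ∧
      ∃ col, ∀ a : Fin d → ℕ, c (fun i => ι i (a i)) = col := by
  induction d with
  | zero =>
    refine ⟨ℕ, fun c => ⟨fun i => i.elim0, fun i => i.elim0, c (fun i => i.elim0), fun a => ?_⟩⟩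
    congr 1
    ext i
    exact i.elim0
  | succ d ih =>
    obtain ⟨X, hX⟩ := ih
    refine ⟨X ⊕ Set (ℕ ⊕ ((Fin d → X) → ℕ)), fun c => ?_⟩
    let F : Set (ℕ ⊕ ((Fin d → X) → ℕ)) → (ℕ ⊕ ((Fin d → X) → ℕ)) := fun y =>
      Sum.inr fun a => c (Fin.snoc (fun i => Sum.inl (a i)) (Sum.inr y))
    obtain ⟨b, hb⟩ := Cardinal.exists_infinite_fiber F (by
      rw [Cardinal.mk_set]; exact Cardinal.cantor _)
    obtain ⟨y₀⟩ := hb.nonempty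
    have e := Infinite.natEmbedding (F ⁻¹' {b})
    obtain ⟨ι, hι, col, hcol⟩ := hX (fun a => c (Fin.snoc (fun i => Sum.inl (a i)) (Sum.inr y₀)))
    refine ⟨Fin.snoc (α := fun _ => ℕ → X ⊕ Set (ℕ ⊕ ((Fin d → X) → ℕ)))
      (fun i m => Sum.inl (ι i m)) (fun m => Sum.inr (e m).1), ?_, col, ?_⟩
    · intro i
      refine Fin.lastCases ?_ (fun i => ?_) i
      · simp only [Fin.snoc_last]
        exact fun x y h => e.injective (Subtype.ext (Sum.inr_injective h))
      · simp only [Fin.snoc_castSucc]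
        exact fun x y h => hι i (Sum.inl_injective h)
    · intro a
      have h1 : F (e (a (Fin.last d))).1 = F y₀ :=
        (e (a (Fin.last d))).2.trans y₀.2.symm
      have h2 := congrFun (Sum.inr_injective h1) (fun i => ι i (a i.castSucc))
      rw [← hcol (fun i => a i.castSucc), ← h2]
      congr 1
      ext i
      refine Fin.lastCases ?_ (fun i => ?_) i <;> simp

theorem exists_injective_grid_of_continuous {d : ℕ} {E : Type*} [TopologicalSpace E] [T2Space E]
    (G : (Fin d → ℝ) → E) (hG : Continuous G) (h1 : OneToOneEachCoord G) :
    ∃ ξ : Fin d → ℝ → ℝ, Function.Injective (fun x : Fin d → ℝ => G (fun i => ξ i (x i))) := by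
  let K := ℕ → Bool
  let tr : ∀ l : ℕ, K → (Fin l → Bool) := fun l x j => x j
  have htr : ∀ l, Continuous (tr l) := fun l => by fun_prop
  let st : C(K, Fin d → ℝ) → (Fin d → K) → (Fin d → ℝ) := fun α x i => α (x i) i
  let O : ℕ → Set C(K, Fin d → ℝ) := fun l =>
    {α | ∀ x y : Fin d → K, (fun i => tr l (x i)) ≠ (fun i => tr l (y i)) →
      G (st α x) ≠ G (st α y)}
  have hopen : ∀ l, IsOpen (O l) := by
    intro l
    let Z : Set (C(K, Fin d → ℝ) × ((Fin d → K) × (Fin d → K))) :=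
      {z | (fun i => tr l (z.2.1 i)) ≠ (fun i => tr l (z.2.2 i)) ∧ G (st z.1 z.2.1) = G (st z.1 z.2.2)}
    have hZ : IsClosed Z := by
      refine IsClosed.inter ?_ ?_
      · have hc : Continuous (fun z : C(K, Fin d → ℝ) × ((Fin d → K) × (Fin d → K)) =>
            ((fun i => tr l (z.2.1 i)), (fun i => tr l (z.2.2 i)))) := by fun_prop
        exact (isClosed_discrete {w : (Fin d → Fin l → Bool) × (Fin d → Fin l → Bool) |
          w.1 ≠ w.2}).preimage hc
      · exact isClosed_eq (by fun_prop) (by fun_prop)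
    have : O l = (Prod.fst '' Z)ᶜ := by
      ext α
      constructor
      · rintro h ⟨⟨_, x, y⟩, ⟨h2, h3⟩, rfl⟩
        exact h x y h2 h3
      · intro h x y h2 h3
        exact h ⟨⟨α, x, y⟩, ⟨h2, h3⟩, rfl⟩
    rw [this]
    exact (isClosedMap_fst_of_compactSpace Z hZ).isOpen_compl
  have hdense : ∀ l, Dense (O l) := by
    intro l
    rw [Metric.dense_iff]
    intro α₀ ε hε
    obtain ⟨m, hlm, hm⟩ : ∃ m, l ≤ m ∧ ∀ x y : K, tr m x = tr m y → dist (α₀ x) (α₀ y) < ε / 4 := by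
      have hU : IsOpen {z : K × K | dist (α₀ z.1) (α₀ z.2) < ε / 4} :=
        isOpen_lt (by fun_prop) continuous_const
      obtain ⟨m, hm⟩ := exists_subset_nhds_of_isCompact'
        (V := fun m : ℕ => {z : K × K | tr m z.1 = tr m z.2})
        (Antitone.directed_ge (fun a b hab z hz => by
          ext j; exact congrFun hz ⟨j, j.2.trans_le hab⟩))
        (fun m => (isClosed_eq (by fun_prop) (by fun_prop)).isCompact)
        (fun m => isClosed_eq (by fun_prop) (by fun_prop))
        (U := {z : K × K | dist (α₀ z.1) (α₀ z.2) < ε / 4}) (by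
          intro z hz
          refine hU.mem_nhds ?_
          have : z.1 = z.2 := by
            ext j
            have := Set.mem_iInter.1 hz (j + 1)
            exact congrFun this ⟨j, Nat.lt_succ_self j⟩
          simp [this]; positivity)
      refine ⟨max l m, le_max_left _ _, fun x y h => ?_⟩
      refine @hm (x, y) ?_
      ext j
      exact congrFun h ⟨j, j.2.trans_le (le_max_right _ _)⟩
    let ex : (Fin m → Bool) → K := fun a j => if h : j < m then a ⟨j, h⟩ else false
    have hex : ∀ x, tr m (ex (tr m x)) = tr m x := by
      intro x; ext j; simp [tr, ex]
    obtain ⟨w, hw⟩ := exists_generic_grid G h1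
      (fun i (lab : Fin m → Bool) (k : ℕ) => α₀ (ex lab) i + ε / 4 / (k + 1)) (by
        intro i lab a b hab
        have h0 : ε / 4 ≠ 0 := by positivity
        have hh := add_left_cancel hab
        have ha : (a : ℝ) + 1 ≠ 0 := by positivity
        have hb : (b : ℝ) + 1 ≠ 0 := by positivity
        rw [div_eq_div_iff ha hb] at hh
        have := mul_left_cancel₀ h0 hh
        exact_mod_cast (add_right_cancel this).symm)
    let c : (Fin m → Bool) → (Fin d → ℝ) := fun lab i => α₀ (ex lab) i + ε / 4 / (w i lab + 1)
    let α : C(K, Fin d → ℝ) := ⟨fun x => c (tr m x),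
      (continuous_of_discreteTopology (f := c)).comp (htr m)⟩
    refine ⟨α, ?_, ?_⟩
    · rw [Metric.mem_ball]
      refine lt_of_le_of_lt ((ContinuousMap.dist_le (C := ε / 2) (by positivity)).2 fun x => ?_)
        (by linarith)
      have h2 := hm (ex (tr m x)) x (hex x)
      have h3 : dist (α x) (α₀ (ex (tr m x))) ≤ ε / 4 := by
        rw [dist_pi_le_iff (by positivity)]
        intro i
        change dist (α₀ (ex (tr m x)) i + ε / 4 / (w i (tr m x) + 1)) _ ≤ _
        rw [Real.dist_eq, add_sub_cancel_left, abs_of_nonneg (by positivity)]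
        apply div_le_self (by positivity)
        have : (0 : ℝ) ≤ w i (tr m x) := by positivity
        linarith
      linarith [dist_triangle (α x) (α₀ (ex (tr m x))) (α₀ x)]
    · intro x y hxy hE
      apply hxy
      have : (fun i => tr m (x i)) = (fun i => tr m (y i)) := hw hE
      ext i j
      exact congrFun (congrFun this i) ⟨j, j.2.trans_le hlm⟩
  obtain ⟨α, hα⟩ := (dense_iInter_of_isOpen hopen hdense).nonempty
  rw [Set.mem_iInter] at hα
  obtain ⟨j⟩ : Nonempty (ℝ ↪ K) := by
    rw [← Cardinal.le_def, Cardinal.mk_real]; simp [K]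
  refine ⟨fun i t => α (j t) i, fun x y hxy => ?_⟩
  by_contra hne
  obtain ⟨i, hi⟩ := Function.ne_iff.1 hne
  obtain ⟨b, hb⟩ := Function.ne_iff.1 (j.injective.ne hi)
  refine hα (b + 1) (fun i => j (x i)) (fun i => j (y i)) (fun h => hb ?_) hxy
  exact congrFun (congrFun h i) ⟨b, Nat.lt_succ_self b⟩

section Models

open MvPolynomial

/-- `f` satisfies the relations `S` along all injective labellings of the pattern `e`,
the nonvanishing condition `r`, and separates points differing in one coordinate by an entry indexed in `J`. -/
structure IsGoodMap {κ Lb σ X A : Type*} {d : ℕ} [CommRing A] [Algebra ℝ A] (e : κ → Fin d → Lb)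
    (S : Set (MvPolynomial (κ × σ) ℝ)) (r : MvPolynomial σ ℝ) (J : Set σ)
    (f : (Fin d → X) → σ → A) : Prop where
  rel : ∀ h : Fin d → Lb → X, (∀ i, Function.Injective (h i)) → ∀ q ∈ S,
    aeval (fun v : κ × σ => f (fun i => h i (e v.1 i)) v.2) q = 0
  ne_zero : ∀ a, aeval (f a) r ≠ 0
  sep : ∀ a b, (∃ i, a i ≠ b i ∧ ∀ j, j ≠ i → a j = b j) → ∃ j ∈ J, f a j ≠ f b j

/-- A map `g` near `0`, strictly differentiable at `0`, satisfying the relations `S` on small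
grids, with every partial derivative at `0` having a nonzero entry indexed in `J`. -/
structure IsSmoothModel {κ Lb σ : Type*} {d : ℕ} [Fintype σ] (e : κ → Fin d → Lb)
    (S : Set (MvPolynomial (κ × σ) ℝ)) (r : MvPolynomial σ ℝ) (J : Set σ)
    (g : (Fin d → ℝ) → σ → ℝ) (g' : (Fin d → ℝ) →L[ℝ] (σ → ℝ)) : Prop where
  deriv : HasStrictFDerivAt g g' 0
  ne_zero : aeval (g 0) r ≠ 0
  deriv_ne : ∀ i, ∃ j ∈ J, g' (Pi.single i 1) j ≠ 0
  rel : ∃ ρ > 0, ∀ t : Fin d → Lb → ℝ, (∀ i l, |t i l| < ρ) → ∀ q ∈ S,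
    aeval (fun v : κ × σ => g (fun i => t i (e v.1 i)) v.2) q = 0

theorem exists_perm_of_fimg_eq {k : ℕ} {V : Type*} {a b : Fin k → V} (ha : Function.Injective a)
    (h : fimg a Finset.univ = fimg b Finset.univ) : ∃ π : Equiv.Perm (Fin k), a = b ∘ π := by
  classical
  have hm : ∀ x, ∃ y, b y = a x := by
    intro x
    have : a x ∈ fimg b Finset.univ := by
      rw [← h]; simp [fimg]
    simpa [fimg] using this
  choose y hy using hm
  have hinj : Function.Injective y := fun u v huv => ha (by rw [← hy, ← hy, huv])
  exact ⟨Equiv.ofBijective y (Finite.injective_iff_bijective.1 hinj), funext fun x => (hy x).symm⟩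

/-- The product of all polynomials obtained from `p` by permuting the `k` points. -/
noncomputable def permProd {k n : ℕ} (p : MvPolynomial (Fin k × Fin n) ℝ) :
    MvPolynomial (Fin k × Fin n) ℝ :=
  ∏ π : Equiv.Perm (Fin k), rename (fun v => (π v.1, v.2)) p

theorem aeval_permProd_eq_zero {k n : ℕ} (p : MvPolynomial (Fin k × Fin n) ℝ)
    (b : Fin k → Fin n → ℝ) : aeval (fun v : Fin k × Fin n => b v.1 v.2) (permProd p) = 0 ↔
      ∃ π : Equiv.Perm (Fin k), eval (fun v => (b ∘ π) v.1 v.2) p = 0 := by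
  simp only [permProd, map_prod, Finset.prod_eq_zero_iff, Finset.mem_univ, true_and, aeval_rename]
  rfl

theorem isGoodMap_of_embeddable {α Lb : Type*} {k n d : ℕ} {p : MvPolynomial (Fin k × Fin n) ℝ}
    {P : Finset (Fin d → α)} (en : Fin k ≃ P) (lab : α → Lb)
    (hlab : ∀ x ∈ P, ∀ y ∈ P, ∀ i, lab (x i) = lab (y i) → x i = y i) {X : Type*}
    (h : Embeddable (LEdges k P X) (zeroEdges k n p)) :
    ∃ f : (Fin d → X) → Fin n → ℝ, IsGoodMap (fun x i => lab ((en x).1 i))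
      {permProd p} 1 Set.univ f := by
  classical
  obtain ⟨f, hf, hE⟩ := h
  refine ⟨f, ?_, ?_, ?_⟩
  · rintro h hh q rfl
    let b : Fin k → Fin d → X := fun x i => h i (lab ((en x).1 i))
    have hb : Function.Injective b := by
      intro x y hxy
      apply en.injective
      ext i
      exact hlab _ (en x).2 _ (en y).2 i (hh i (congrFun hxy i))
    have hQ : Finset.univ.image b ∈ LEdges k P X := by
      refine ⟨by rw [Finset.card_image_of_injective _ hb]; simp,
        fun z i => h i (lab (z i)), ?_, ?_, ?_⟩
      · intro x hx
        rw [Finset.mem_image]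
        exact ⟨en.symm ⟨x, hx⟩, Finset.mem_univ _, by simp [b]⟩
      · intro y hy
        obtain ⟨x, -, rfl⟩ := Finset.mem_image.1 hy
        exact ⟨_, (en x).2, rfl⟩
      · intro x _ y _ i hi
        simp [hi]
    obtain ⟨a, ha, ha1, ha2⟩ := hE _ hQ
    obtain ⟨π, hπ⟩ := exists_perm_of_fimg_eq (b := f ∘ b) ha (by
      rw [ha1]; unfold fimg; ext; simp)
    exact (aeval_permProd_eq_zero p (f ∘ b)).2 ⟨π, by rw [← hπ]; exact ha2⟩
  · intro a; simp
  · rintro a b ⟨i, hi, -⟩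
    have : f a ≠ f b := hf.ne fun h => hi (by rw [h])
    obtain ⟨j, hj⟩ := Function.ne_iff.1 this
    exact ⟨j, trivial, hj⟩

theorem HasStrictFDerivAt.oneToOne_near {d : ℕ} {σ : Type*} [Fintype σ]
    {g : (Fin d → ℝ) → σ → ℝ} {g' : (Fin d → ℝ) →L[ℝ] (σ → ℝ)} (hg : HasStrictFDerivAt g g' 0)
    (hne : ∀ i, ∃ j, g' (Pi.single i 1) j ≠ 0) :
    ∃ ρ > 0, ContinuousOn g (Metric.ball 0 ρ) ∧ ∀ x ∈ Metric.ball (0 : Fin d → ℝ) ρ,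
      ∀ y ∈ Metric.ball (0 : Fin d → ℝ) ρ,
      (∃ i, x i ≠ y i ∧ ∀ j, j ≠ i → x j = y j) → g x ≠ g y := by
  choose j hj using hne
  obtain ⟨K, s, hs, hK⟩ := hg.exists_lipschitzOnWith
  have hev : ∀ i, ∀ᶠ z in nhds (((0 : Fin d → ℝ)), (0 : Fin d → ℝ)),
      ‖g z.1 - g z.2 - g' (z.1 - z.2)‖ ≤ (|g' (Pi.single i 1) (j i)| / 2) * ‖z.1 - z.2‖ := by
    intro i
    exact hg.isLittleO.bound (by have := abs_pos.2 (hj i); positivity)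
  have hev' := Filter.eventually_all.2 hev
  rw [Metric.eventually_nhds_iff_ball] at hev'
  obtain ⟨ρ₁, h1, h2⟩ := hev'
  obtain ⟨ρ₂, h3, h4⟩ := Metric.mem_nhds_iff.1 hs
  refine ⟨min ρ₁ ρ₂, lt_min h1 h3, hK.continuousOn.mono
    ((Metric.ball_subset_ball (min_le_right _ _)).trans h4), ?_⟩
  rintro x hx y hy ⟨i, hi, hij⟩ hxy
  have hx' := Metric.ball_subset_ball (min_le_left _ _) hx
  have hy' := Metric.ball_subset_ball (min_le_left _ _) hy
  have := h2 (x, y) (by rw [← ball_prod_same]; exact ⟨hx', hy'⟩) i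
  have hd : x - y = (x i - y i) • Pi.single i (1 : ℝ) := by
    ext l
    by_cases hl : l = i
    · subst hl; simp
    · simp [hl, hij l hl]
  simp only at this
  rw [hxy, sub_self, zero_sub, norm_neg, hd, map_smul, norm_smul, norm_smul] at this
  have h5 : 0 < ‖x i - y i‖ := norm_pos_iff.2 (sub_ne_zero.2 hi)
  have h6 := norm_le_pi_norm (g' (Pi.single i 1)) (j i)
  have h7 := abs_pos.2 (hj i)
  rw [Real.norm_eq_abs (g' _ _)] at h6
  rw [Pi.norm_single, norm_one] at this
  nlinarith

theorem IsSmoothModel.embeddable {α Lb : Type*} {k n d : ℕ} {p : MvPolynomial (Fin k × Fin n) ℝ}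
    {P : Finset (Fin d → α)} (en : Fin k ≃ P) (lab : α → Lb)
    (hlab : ∀ x ∈ P, ∀ y ∈ P, ∀ i, lab (x i) = lab (y i) → x i = y i)
    {g : (Fin d → ℝ) → Fin n → ℝ} {g' : (Fin d → ℝ) →L[ℝ] (Fin n → ℝ)} {J : Set (Fin n)}
    {r : MvPolynomial (Fin n) ℝ}
    (hg : IsSmoothModel (fun x i => lab ((en x).1 i)) {permProd p} r J g g') :
    Embeddable (LEdges k P ℝ) (zeroEdges k n p) := by
  classical
  obtain ⟨ρ₁, h1, hcont, hone⟩ := hg.deriv.oneToOne_near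
    fun i => (hg.deriv_ne i).imp fun _ h => h.2
  obtain ⟨ρ₂, h2, hrel⟩ := hg.rel
  let ρ := min ρ₁ ρ₂
  have hρ : 0 < ρ := lt_min h1 h2
  let τ : ℝ → ℝ := fun t => ρ / 2 * Real.arctan t
  have hτ : ∀ t, |τ t| < ρ := by
    intro t
    have h3 : |Real.arctan t| < 2 := by
      rw [abs_lt]
      constructor <;>
        linarith [Real.arctan_lt_pi_div_two t, Real.neg_pi_div_two_lt_arctan t, Real.pi_lt_four]
    simp only [τ, abs_mul, abs_of_pos (half_pos hρ)]
    nlinarith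
  have hτi : Function.Injective τ := fun x y h =>
    Real.arctan_injective (mul_left_cancel₀ (by positivity) h)
  have hmem : ∀ x : Fin d → ℝ, (fun i => τ (x i)) ∈ Metric.ball (0 : Fin d → ℝ) ρ₁ := by
    intro x
    rw [mem_ball_zero_iff, pi_norm_lt_iff h1]
    exact fun i => (hτ _).trans_le (min_le_left _ _)
  obtain ⟨ξ, hξ⟩ := exists_injective_grid_of_continuous
    (fun x : Fin d → ℝ => g (fun i => τ (x i)))
    (hcont.comp_continuous (by fun_prop) hmem)
    (by
      rintro a b ⟨i, hi, hij⟩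
      exact hone _ (hmem a) _ (hmem b) ⟨i, hτi.ne hi, fun j hj => by rw [hij j hj]⟩)
  set f : (Fin d → ℝ) → Fin n → ℝ := fun x => g (fun i => τ (ξ i (x i))) with hf
  refine ⟨f, hξ, ?_⟩
  rintro Q ⟨hQ, φ, hφ1, hφ2, hφ3⟩
  have himg : P.image φ = Q := by
    ext y
    rw [Finset.mem_image]
    exact ⟨by rintro ⟨x, hx, rfl⟩; exact hφ1 x hx, hφ2 y⟩
  have hcard : P.card = k := by
    have := Fintype.card_congr en
    simpa using this.symm
  have hinj : Set.InjOn φ P := by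
    rw [← Finset.card_image_iff, himg, hQ, hcard]
  let t : Fin d → Lb → ℝ := fun i =>
    Function.extend (fun x : Fin k => lab ((en x).1 i)) (fun x => τ (ξ i (φ (en x).1 i))) (fun _ => 0)
  have ht : ∀ i x, t i (lab ((en x).1 i)) = τ (ξ i (φ (en x).1 i)) := by
    intro i x
    refine Function.FactorsThrough.extend_apply (fun x y hxy => ?_) _ x
    rw [hφ3 _ (en x).2 _ (en y).2 i (hlab _ (en x).2 _ (en y).2 i hxy)]
  have hz := hrel t (by
    intro i l
    refine lt_of_lt_of_le ?_ (min_le_right ρ₁ ρ₂)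
    by_cases hl : ∃ x : Fin k, lab ((en x).1 i) = l
    · obtain ⟨x, rfl⟩ := hl
      rw [ht]; exact hτ _
    · have : t i l = 0 := Function.extend_apply' _ _ _ hl
      rw [this, abs_zero]; exact hρ) _ rfl
  simp only [ht] at hz
  obtain ⟨π, hπ⟩ := (aeval_permProd_eq_zero p (fun x => f (φ (en x).1))).1 hz
  refine ⟨_, ?_, ?_, hπ⟩
  · have : Function.Injective fun x => f (φ (en x).1) := fun x y h =>
      en.injective (Subtype.ext (hinj (en x).2 (en y).2 (hξ h)))
    exact this.comp π.injective
  · ext y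
    unfold fimg
    simp only [Finset.mem_image, Finset.mem_univ, true_and, Function.comp]
    constructor
    · rintro ⟨x, rfl⟩
      exact ⟨_, hφ1 _ (en (π x)).2, rfl⟩
    · rintro ⟨z, hz, rfl⟩
      obtain ⟨x, hx, rfl⟩ := hφ2 z hz
      exact ⟨π.symm (en.symm ⟨x, hx⟩), by simp⟩

theorem embeddable_iff_immersible_of_smoothModel {α : Type*} (k n d : ℕ)
    (hmodel : ∀ {κ Lb σ : Type} [Fintype κ] [Fintype Lb] [Fintype σ] (e : κ → Fin d → Lb)
      (S : Set (MvPolynomial (κ × σ) ℝ)) (r : MvPolynomial σ ℝ) (J : Set σ),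
      (∀ M : ℕ, ∃ f : (Fin d → Fin M) → σ → ℝ, IsGoodMap e S r J f) →
      ∃ g g', IsSmoothModel e S r J g g')
    (p : MvPolynomial (Fin k × Fin n) ℝ) (P : Finset (Fin d → α)) (hP : P.card = k) :
    ((∀ M : ℕ, Embeddable (LEdges k P (Fin M)) (zeroEdges k n p)) ↔
        Embeddable (LEdges k P ℝ) (zeroEdges k n p)) ∧
    (Embeddable (LEdges k P ℝ) (zeroEdges k n p) ↔
        ∃ f : (Fin d → ℝ) → (Fin n → ℝ), IsImmersion k P (zeroEdges k n p) f) := by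
  classical
  have h23 : Embeddable (LEdges k P ℝ) (zeroEdges k n p) →
      ∃ f : (Fin d → ℝ) → (Fin n → ℝ), IsImmersion k P (zeroEdges k n p) f := by
    rintro ⟨f, hf, hE⟩
    exact ⟨f, fun a b ⟨i, hi, _⟩ => hf.ne fun h => hi (by rw [h]), fun Q hQ _ => hE Q hQ⟩
  have h31 : (∃ f : (Fin d → ℝ) → (Fin n → ℝ), IsImmersion k P (zeroEdges k n p) f) →
      ∀ M : ℕ, Embeddable (LEdges k P (Fin M)) (zeroEdges k n p) :=
    fun ⟨_, hf⟩ M => hf.embeddable_fin M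
  have h12 : (∀ M : ℕ, Embeddable (LEdges k P (Fin M)) (zeroEdges k n p)) →
      Embeddable (LEdges k P ℝ) (zeroEdges k n p) := by
    intro h
    let en : Fin k ≃ P := (P.equivFinOfCardEq hP).symm
    let T : Finset α := P.biUnion fun x => Finset.univ.image x
    let lab : α → Fin (T.card + 1) := fun a =>
      if h : a ∈ T then (T.equivFin ⟨a, h⟩).castSucc else Fin.last _
    have hlab : ∀ x ∈ P, ∀ y ∈ P, ∀ i, lab (x i) = lab (y i) → x i = y i := by
      intro x hx y hy i hxy
      have hT : ∀ x ∈ P, x i ∈ T := fun x hx => by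
        rw [Finset.mem_biUnion]; exact ⟨x, hx, Finset.mem_image_of_mem _ (Finset.mem_univ _)⟩
      simpa [lab, hT x hx, hT y hy] using hxy
    obtain ⟨g, g', hg⟩ := hmodel _ _ _ _ fun M => isGoodMap_of_embeddable en lab hlab (h M)
    exact hg.embeddable en lab hlab
  exact ⟨⟨h12, fun h => h31 (h23 h)⟩, h23, fun h => h12 (h31 h)⟩

section Ultrapower

variable {ι A : Type} [Field A]

/-- The ideal of functions vanishing `U`-almost everywhere. -/
def eventuallyZeroIdeal (A : Type) [Field A] (U : Ultrafilter ι) : Ideal (ι → A) where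
  carrier := {φ | ∀ᶠ i in U, φ i = 0}
  add_mem' := by
    intro a b ha hb
    filter_upwards [ha, hb] with i h1 h2
    simp [h1, h2]
  zero_mem' := by simp
  smul_mem' := by
    intro c a ha
    filter_upwards [ha] with i h1
    simp [h1]

theorem mem_eventuallyZeroIdeal {U : Ultrafilter ι} {φ : ι → A} :
    φ ∈ eventuallyZeroIdeal A U ↔ ∀ᶠ i in U, φ i = 0 := Iff.rfl

theorem eventuallyZeroIdeal_isMaximal (U : Ultrafilter ι) :
    (eventuallyZeroIdeal A U).IsMaximal := by
  rw [Ideal.isMaximal_iff]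
  constructor
  · simpa [mem_eventuallyZeroIdeal] using U.neBot.ne
  · intro J φ hJ hφ hφJ
    rw [mem_eventuallyZeroIdeal, ← Ultrafilter.eventually_not] at hφ
    have h1 : φ * φ⁻¹ - 1 ∈ J := hJ (by
      rw [mem_eventuallyZeroIdeal]
      filter_upwards [hφ] with i hi
      simp [mul_inv_cancel₀ hi])
    have h2 := J.mul_mem_right φ⁻¹ hφJ
    simpa using J.sub_mem h2 h1

theorem exists_ultrapower (A : Type) [Field A] (U : Ultrafilter ι) :
    ∃ (B : Type) (_ : Field B) (_ : Algebra A B) (π : (ι → A) →ₐ[A] B),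
      Function.Surjective π ∧ ∀ φ, π φ = 0 ↔ ∀ᶠ i in U, φ i = 0 := by
  have := eventuallyZeroIdeal_isMaximal (A := A) U
  refine ⟨(ι → A) ⧸ eventuallyZeroIdeal A U, Ideal.Quotient.field _, inferInstance,
    Ideal.Quotient.mkₐ A _, Ideal.Quotient.mkₐ_surjective _ _, fun φ => ?_⟩
  rw [Ideal.Quotient.mkₐ_eq_mk, Ideal.Quotient.eq_zero_iff_mem, mem_eventuallyZeroIdeal]

theorem aeval_ultrapower {R B σ : Type*} [CommRing R] [CommRing B] [Algebra R A] [Algebra R B]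
    {U : Ultrafilter ι} {π : (ι → A) →ₐ[R] B} (hπ : ∀ φ, π φ = 0 ↔ ∀ᶠ i in U, φ i = 0)
    (φ : σ → ι → A) (q : MvPolynomial σ R) :
    aeval (fun v => π (φ v)) q = 0 ↔ ∀ᶠ i in U, aeval (fun v => φ v i) q = 0 := by
  have h1 : aeval (fun v => π (φ v)) q = π (aeval φ q) := by
    rw [← MvPolynomial.comp_aeval_apply]
  have h2 : ∀ i, aeval φ q i = aeval (fun v => φ v i) q := by
    intro i
    have := MvPolynomial.comp_aeval_apply φ (Pi.evalAlgHom R (fun _ : ι => A) i) q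
    simpa using this
  rw [h1, hπ]
  simp only [h2]

end Ultrapower

/-- Every finite tuple `w` of `A` with `r(w) ≠ 0` specializes to a real tuple which still satisfies
`r ≠ 0` and all the real polynomial relations of `w`. -/
def RealSpecializes (A : Type) [CommRing A] [Algebra ℝ A] : Prop :=
  ∀ (σ : Type) [Finite σ] (w : σ → A) (r : MvPolynomial σ ℝ), aeval w r ≠ 0 →
    ∃ w' : σ → ℝ, aeval w' r ≠ 0 ∧ ∀ q : MvPolynomial σ ℝ, aeval w q = 0 → aeval w' q = 0

theorem realSpecializes_real : RealSpecializes ℝ := fun _ _ w _ hr => ⟨w, hr, fun _ h => h⟩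

theorem RealSpecializes.ultrapower {ι A B : Type} [Field A] [CommRing B] [Algebra ℝ A] [Algebra ℝ B]
    {U : Ultrafilter ι} {π : (ι → A) →ₐ[ℝ] B} (hs : Function.Surjective π)
    (hπ : ∀ φ, π φ = 0 ↔ ∀ᶠ i in U, φ i = 0) (hA : RealSpecializes A) : RealSpecializes B := by
  intro σ _ w r hr
  choose φ hφ using fun v => hs (w v)
  obtain rfl : (fun v => π (φ v)) = w := funext hφ
  rw [Ne, aeval_ultrapower hπ, ← Ultrafilter.eventually_not] at hr
  obtain ⟨G, hG⟩ := IsNoetherian.noetherian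
    (RingHom.ker (aeval (R := ℝ) (fun v => π (φ v))).toRingHom)
  have hall : ∀ᶠ i in U, ∀ q ∈ G, aeval (fun v => φ v i) q = 0 := by
    rw [Filter.eventually_all_finset]
    intro q hq
    rw [← aeval_ultrapower hπ]
    have : q ∈ RingHom.ker (aeval (R := ℝ) (fun v => π (φ v))).toRingHom := by
      rw [← hG]; exact Submodule.subset_span hq
    exact this
  obtain ⟨i, hi1, hi2⟩ := (hr.and hall).exists
  obtain ⟨w', h1, h2⟩ := hA σ _ r hi1
  refine ⟨w', h1, fun q hq => h2 q ?_⟩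
  have hq' : q ∈ Submodule.span (MvPolynomial σ ℝ) (G : Set (MvPolynomial σ ℝ)) := by
    rw [hG]; exact hq
  have hle : Submodule.span (MvPolynomial σ ℝ) (G : Set (MvPolynomial σ ℝ)) ≤
      RingHom.ker (aeval (R := ℝ) (fun v => φ v i)).toRingHom :=
    Submodule.span_le.2 fun q hq => hi2 q hq
  exact hle hq'

theorem RealSpecializes.mvPolynomial {A : Type} [Field A] [CharZero A] [Algebra ℝ A] (hA : RealSpecializes A)
    (T : Type) : RealSpecializes (MvPolynomial T A) := by
  intro σ _ w r hr
  obtain ⟨x, hx⟩ : ∃ x : T → A, eval x (aeval w r) ≠ 0 := by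
    by_contra! h
    exact hr (MvPolynomial.funext fun x => by simp [h x])
  have hcomp : ∀ q : MvPolynomial σ ℝ, aeval (fun v => eval x (w v)) q = eval x (aeval w q) := by
    intro q
    have := MvPolynomial.comp_aeval_apply w ((aeval (R := A) x).restrictScalars ℝ) q
    simpa [MvPolynomial.coe_aeval_eq_eval] using this.symm
  obtain ⟨w', h1, h2⟩ := hA σ (fun v => eval x (w v)) r (by rwa [hcomp])
  exact ⟨w', h1, fun q hq => h2 q (by rw [hcomp, hq, map_zero])⟩

theorem exists_isGoodMap_ultrapower {κ Lb σ : Type} [Finite Lb] [Finite σ] {d : ℕ}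
    {e : κ → Fin d → Lb} {S : Set (MvPolynomial (κ × σ) ℝ)} {r : MvPolynomial σ ℝ} {J : Set σ}
    (H : ∀ M : ℕ, ∃ f : (Fin d → Fin M) → σ → ℝ, IsGoodMap e S r J f) (Y : Type) :
    ∃ (B : Type) (_ : Field B) (_ : Algebra ℝ B) (f : (Fin d → Y) → σ → B),
      RealSpecializes B ∧ IsGoodMap e S r J f := by
  classical
  let U : Ultrafilter (Finset Y) := Ultrafilter.of Filter.atTop
  have hU : ∀ s : Finset Y, ∀ᶠ t in U, s ⊆ t := fun s =>
    (Ultrafilter.of_le _ : (U : Filter (Finset Y)) ≤ Filter.atTop) (Filter.eventually_ge_atTop s)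
  obtain ⟨B, _, _, π, hsurj, hπ⟩ := exists_ultrapower ℝ U
  choose F hF using H
  let lab : ∀ s : Finset Y, Y → Fin (s.card + 1) := fun s y =>
    if h : y ∈ s then (s.equivFin ⟨y, h⟩).castSucc else Fin.last _
  have hlab : ∀ s : Finset Y, ∀ x ∈ s, ∀ y ∈ s, lab s x = lab s y → x = y := by
    intro s x hx y hy h
    simpa [lab, hx, hy] using h
  refine ⟨B, inferInstance, inferInstance,
    fun a j => π (fun s => F (s.card + 1) (fun i => lab s (a i)) j),
    realSpecializes_real.ultrapower hsurj hπ, ?_, ?_, ?_⟩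
  · intro h hh q hq
    rw [aeval_ultrapower hπ (fun (v : κ × σ) s =>
      F (s.card + 1) (fun i => lab s (h i (e v.1 i))) v.2)]
    have hfin : (⋃ i, Set.range (h i)).Finite := Set.finite_iUnion fun i => Set.finite_range _
    filter_upwards [hU hfin.toFinset] with s hs
    refine (hF (s.card + 1)).rel (fun i l => lab s (h i l)) (fun i l m hlm => hh i ?_) q hq
    have hm : ∀ l, h i l ∈ s := fun l => hs (hfin.mem_toFinset.2 (Set.mem_iUnion.2 ⟨i, l, rfl⟩))
    exact hlab s _ (hm l) _ (hm m) hlm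
  · intro a
    rw [Ne, aeval_ultrapower hπ (fun j s => F (s.card + 1) (fun i => lab s (a i)) j),
      ← Ultrafilter.eventually_not]
    exact Filter.Eventually.of_forall fun s => (hF _).ne_zero _
  · rintro a b ⟨i, hi, hij⟩
    by_contra! hne
    have hev : ∀ᶠ s in U, ∀ j, j ∈ J → F (s.card + 1) (fun i => lab s (a i)) j =
        F (s.card + 1) (fun i => lab s (b i)) j := by
      rw [Filter.eventually_all]
      intro j
      by_cases hj : j ∈ J
      · have := hne j hj
        rw [← sub_eq_zero, ← map_sub, hπ] at this
        filter_upwards [this] with s hs _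
        exact sub_eq_zero.1 hs
      · exact Filter.Eventually.of_forall fun s h => absurd h hj
    obtain ⟨s, hs1, hs2⟩ := (hev.and (hU {a i, b i})).exists
    obtain ⟨j, hj, hne'⟩ := (hF (s.card + 1)).sep (fun i => lab s (a i)) (fun i => lab s (b i))
      ⟨i, fun h => hi (hlab s _ (hs2 (by simp)) _ (hs2 (by simp)) h), fun j hj => by
        rw [hij j hj]⟩
    exact hne' (hs1 j hj)

theorem exists_sum_basis_mul_map {F W ν κ : Type*} [Field F] [CommRing W] [Algebra F W]
    (β : Module.Basis κ F W) (Q : MvPolynomial ν W) : ∃ c : κ →₀ MvPolynomial ν F,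
      Q = c.sum fun k q => C (β k) * map (algebraMap F W) q := by
  classical
  induction Q using MvPolynomial.induction_on' with
  | monomial m w =>
    refine ⟨(β.repr w).mapRange (monomial m) (map_zero _), ?_⟩
    rw [Finsupp.sum_mapRange_index (by simp)]
    conv_lhs => rw [← β.linearCombination_repr w, Finsupp.linearCombination_apply, Finsupp.sum,
      map_sum]
    refine Finset.sum_congr rfl fun k _ => ?_
    simp only [map_monomial, C_mul_monomial, Algebra.smul_def, mul_comm (β k)]
  | add p q hp hq =>
    obtain ⟨c, hc⟩ := hp
    obtain ⟨c', hc'⟩ := hq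
    refine ⟨c + c', ?_⟩
    rw [Finsupp.sum_add_index' (by simp) (by intros; simp [mul_add]), ← hc, ← hc']

theorem aeval_eq_zero_of_eventually {F K W ν : Type} [Field F] [Field K] [CommRing W] [Algebra F K]
    [Algebra F W] {ι : Type} {U : Ultrafilter ι} {π : (ι → F) →ₐ[F] K}
    (hπ : ∀ φ, π φ = 0 ↔ ∀ᶠ i in U, φ i = 0) (E : K →ₐ[F] W) (s : ν → ι → F)
    (Q : MvPolynomial ν W)
    (hQ : ∀ᶠ i in U, eval (fun v => algebraMap F W (s v i)) Q = 0) :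
    eval (fun v => E (π (s v))) Q = 0 := by
  let β := Module.Free.chooseBasis F W
  obtain ⟨c, hc⟩ := exists_sum_basis_mul_map β Q
  have h1 : ∀ k ∈ c.support, ∀ᶠ i in U, aeval (fun v => s v i) (c k) = 0 := by
    intro k hk
    filter_upwards [hQ] with i hi
    rw [hc, Finsupp.sum, map_sum] at hi
    have := linearIndependent_iff'.1 β.linearIndependent c.support
      (fun k => aeval (fun v => s v i) (c k)) (by
        rw [← hi]
        refine Finset.sum_congr rfl fun k _ => ?_
        rw [map_mul, eval_C, eval_map, Algebra.smul_def, mul_comm]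
        congr 1
        have := MvPolynomial.comp_aeval_apply (fun v => s v i) (Algebra.ofId F W) (c k)
        exact this)
    exact this k hk
  rw [hc, Finsupp.sum, map_sum]
  refine Finset.sum_eq_zero fun k hk => ?_
  have h2 := (aeval_ultrapower hπ s (c k)).2 (h1 k hk)
  rw [map_mul, eval_map]
  have h3 : eval₂ (algebraMap F W) (fun v => E (π (s v))) (c k) =
      E (aeval (fun v => π (s v)) (c k)) := by
    exact (MvPolynomial.comp_aeval_apply (fun v => π (s v)) E (c k)).symm
  rw [h3, h2, map_zero, mul_zero]

theorem aeval_exp_eq_zero {F K W ν Lb : Type} [Field F] [Field K] [CommRing W] [Algebra F K]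
    [Algebra F W] [Algebra ℝ F] [Algebra ℝ W] [IsScalarTower ℝ F W] [Finite Lb]
    {π : (ℕ → F) →ₐ[F] K}
    (hπ : ∀ φ, π φ = 0 ↔ ∀ᶠ i in (Filter.hyperfilter ℕ : Filter ℕ), φ i = 0)
    (E : Lb → K →ₐ[F] W) (L : ν → Lb) (s : ν → ℕ → F) (q : MvPolynomial ν ℝ)
    (hq : ∀ b : Lb → ℕ, Function.Injective b → aeval (fun v => s v (b (L v))) q = 0) :
    aeval (fun v => E (L v) (π (s v))) q = 0 := by
  classical
  have := Fintype.ofFinite Lb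
  have key : ∀ T : Finset Lb, ∀ b : Lb → ℕ, Set.InjOn b (T : Set Lb)ᶜ →
      aeval (fun v => if L v ∈ T then E (L v) (π (s v)) else algebraMap F W (s v (b (L v)))) q = 0 := by
    intro T
    induction T using Finset.induction_on with
    | empty =>
      intro b hb
      have := hq b (by simpa using hb)
      have h2 := MvPolynomial.comp_aeval_apply (fun v => s v (b (L v))) (IsScalarTower.toAlgHom ℝ F W) q
      rw [this, map_zero] at h2
      simpa using h2.symm
    | insert l T hl ih =>
      intro b hb
      let z : ν → MvPolynomial ν W := fun v =>
        if L v ∈ T then C (E (L v) (π (s v))) else if L v = l then X v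
          else C (algebraMap F W (s v (b (L v))))
      have hz : ∀ y : ν → W, eval y (aeval z q) = aeval (fun v =>
          if L v ∈ T then E (L v) (π (s v)) else if L v = l then y v
          else algebraMap F W (s v (b (L v)))) q := by
        intro y
        have := MvPolynomial.comp_aeval_apply z ((aeval (R := W) y).restrictScalars ℝ) q
        simp only [AlgHom.coe_restrictScalars', MvPolynomial.aeval_eq_eval] at this
        rw [this]
        congr 2
        ext v
        simp only [z]
        split_ifs <;> simp
      have h0 := aeval_eq_zero_of_eventually hπ (E l) s (aeval z q) (by
        have hco : ∀ᶠ i in (Filter.hyperfilter ℕ : Filter ℕ), ∀ l', b l' ≠ i := by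
          rw [Filter.eventually_all]
          intro l'
          filter_upwards [(Set.finite_singleton (b l')).compl_mem_hyperfilter] with x hx h
          exact hx h.symm
        filter_upwards [hco] with i hi
        rw [hz]
        have := ih (Function.update b l i) (by
          intro x hx y hy hxy
          by_cases hxl : x = l <;> by_cases hyl : y = l
          · rw [hxl, hyl]
          · rw [hxl, Function.update_self, Function.update_of_ne hyl] at hxy
            exact absurd hxy.symm (hi y)
          · rw [hyl, Function.update_self, Function.update_of_ne hxl] at hxy
            exact absurd hxy (hi x)
          · rw [Function.update_of_ne hyl, Function.update_of_ne hxl] at hxy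
            refine hb ?_ ?_ hxy
            · simpa [hxl] using hx
            · simpa [hyl] using hy)
        rw [← this]
        congr 2
        ext v
        split_ifs with h1 h2
        · rfl
        · rw [h2, Function.update_self]
        · rw [Function.update_of_ne h2])
      rw [hz] at h0
      rw [← h0]
      congr 2
      ext v
      by_cases h1 : L v ∈ T
      · simp [h1]
      · by_cases h2 : L v = l
        · simp [h2, hl]
        · simp [h1, h2]
  have := key Finset.univ (fun _ => 0) (by simp)
  simpa using this

theorem derivation_aeval {W ν : Type*} [CommRing W] [Algebra ℝ W] (δ : Derivation ℝ W W)
    (w : ν → W) (p : ν → MvPolynomial ν ℝ) (h : ∀ v, δ (w v) = aeval w (p v))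
    (q : MvPolynomial ν ℝ) : δ (aeval w q) = aeval w (mkDerivation ℝ p q) := by
  induction q using MvPolynomial.induction_on with
  | C a =>
    rw [← MvPolynomial.algebraMap_eq, AlgHom.commutes, Derivation.map_algebraMap,
      Derivation.map_algebraMap, map_zero]
  | add p q hp hq => simp [hp, hq]
  | mul_X q v hq =>
    simp only [map_mul, Derivation.leibniz, smul_eq_mul, hq, aeval_X, h, map_add, mkDerivation_X]

section Exp

variable {F A : Type*} [CommRing F] [CommRing A] [Algebra F A] [Algebra ℝ F] [Algebra ℝ A]
  [IsScalarTower ℝ F A]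

/-- The formal flow `exp (s t D) a` as a power series in `t`. -/
noncomputable def expSeries (D : Derivation F A A) (s : ℝ) (a : A) : PowerSeries A :=
  PowerSeries.mk fun m => (s ^ m / m.factorial : ℝ) • D^[m] a

omit [Algebra ℝ F] [IsScalarTower ℝ F A] in
theorem expSeries_add (D : Derivation F A A) (s : ℝ) (a b : A) :
    expSeries D s (a + b) = expSeries D s a + expSeries D s b := by
  ext m
  simp [expSeries, iterate_map_add]

omit [Algebra ℝ F] [IsScalarTower ℝ F A] in
theorem derivative_expSeries (D : Derivation F A A) (s : ℝ) (a : A) :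
    PowerSeries.derivative A (expSeries D s a) = s • expSeries D s (D a) := by
  ext m
  rw [PowerSeries.coeff_derivative]
  simp only [expSeries, PowerSeries.coeff_mk, PowerSeries.coeff_smul, Function.iterate_succ_apply]
  rw [mul_comm, ← Nat.cast_succ, ← nsmul_eq_mul, ← Nat.cast_smul_eq_nsmul ℝ, smul_smul, smul_smul]
  congr 1
  rw [Nat.factorial_succ]
  push_cast
  field_simp
  ring

omit [Algebra ℝ F] [IsScalarTower ℝ F A] in
theorem constantCoeff_expSeries (D : Derivation F A A) (s : ℝ) (a : A) :
    PowerSeries.constantCoeff (expSeries D s a) = a := by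
  rw [← PowerSeries.coeff_zero_eq_constantCoeff_apply]
  simp [expSeries]

omit [Algebra ℝ F] [IsScalarTower ℝ F A] in
theorem expSeries_mul (D : Derivation F A A) (s : ℝ) (a b : A) :
    expSeries D s (a * b) = expSeries D s a * expSeries D s b := by
  ext m
  induction m generalizing a b with
  | zero =>
    rw [PowerSeries.coeff_zero_eq_constantCoeff_apply, PowerSeries.coeff_zero_eq_constantCoeff_apply,
      map_mul]
    simp only [constantCoeff_expSeries]
  | succ m ih =>
    have h : PowerSeries.coeff m (PowerSeries.derivative A (expSeries D s (a * b))) =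
        PowerSeries.coeff m (PowerSeries.derivative A (expSeries D s a * expSeries D s b)) := by
      rw [Derivation.leibniz, derivative_expSeries, derivative_expSeries, derivative_expSeries,
        Derivation.leibniz, expSeries_add]
      simp only [smul_eq_mul, mul_smul_comm, map_add, PowerSeries.coeff_smul, ih, smul_add]
    rw [PowerSeries.coeff_derivative, PowerSeries.coeff_derivative] at h
    have h2 : ∀ x y : A, x * ((m : A) + 1) = y * ((m : A) + 1) → x = y := by
      intro x y hxy
      have hm : ((m : ℝ) + 1) ≠ 0 := by positivity
      have h3 : ∀ z : A, ((m : ℝ) + 1)⁻¹ • (z * ((m : A) + 1)) = z := by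
        intro z
        have : z * ((m : A) + 1) = ((m : ℝ) + 1) • z := by
          rw [Algebra.smul_def, mul_comm]; simp
        rw [this, smul_smul, inv_mul_cancel₀ hm, one_smul]
      rw [← h3 x, hxy, h3]
    exact h2 _ _ h

/-- `expSeries` as an algebra homomorphism. -/
noncomputable def expSeriesHom (D : Derivation F A A) (s : ℝ) : A →ₐ[F] PowerSeries A where
  toFun := expSeries D s
  map_one' := by
    ext m
    cases m <;> simp [expSeries, PowerSeries.coeff_one]
  map_mul' := expSeries_mul D s
  map_zero' := by
    ext m
    simp [expSeries]
  map_add' := expSeries_add D s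
  commutes' c := by
    ext m
    cases m <;> simp [expSeries, PowerSeries.algebraMap_apply, PowerSeries.coeff_C]

/-- The derivation describing the flow of `P` on every point `x`, run at speed `s (L x)`. -/
noncomputable def flowDerivation {κ Lb σ : Type*} (L : κ → Lb) (P : σ → MvPolynomial σ ℝ)
    (s : Lb → ℝ) : Derivation ℝ (MvPolynomial (κ × σ) ℝ) (MvPolynomial (κ × σ) ℝ) :=
  mkDerivation ℝ fun v => s (L v.1) • rename (fun i => (v.1, i)) (P v.2)

theorem aeval_iterate_flowDerivation {κ Lb σ : Type*} (L : κ → Lb) (P : σ → MvPolynomial σ ℝ)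
    (s : Lb → ℝ) (D : Derivation F A A) (u : κ → σ → A)
    (hu : ∀ x i, D (u x i) = aeval (u x) (P i)) (q : MvPolynomial (κ × σ) ℝ)
    (hq : aeval (fun v : κ × σ => expSeriesHom D (s (L v.1)) (u v.1 v.2)) q = 0) (m : ℕ) :
    aeval (fun v : κ × σ => u v.1 v.2) ((flowDerivation L P s)^[m] q) = 0 := by
  set w : κ × σ → PowerSeries A := fun v => expSeriesHom D (s (L v.1)) (u v.1 v.2) with hw
  have h1 : ∀ m, aeval w ((flowDerivation L P s)^[m] q) = 0 := by
    intro m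
    induction m with
    | zero => exact hq
    | succ m ih =>
      rw [Function.iterate_succ_apply', flowDerivation,
        ← derivation_aeval ((PowerSeries.derivative A).restrictScalars ℝ) w]
      · rw [← flowDerivation, ih, map_zero]
      · intro v
        have h2 : aeval w (rename (fun i => (v.1, i)) (P v.2)) =
            expSeriesHom D (s (L v.1)) (aeval (u v.1) (P v.2)) := by
          rw [aeval_rename]
          exact (MvPolynomial.comp_aeval_apply (u v.1)
            ((expSeriesHom D (s (L v.1))).restrictScalars ℝ) (P v.2)).symm
        rw [map_smul, h2, ← hu]
        exact derivative_expSeries D _ _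
  have h3 : ∀ q : MvPolynomial (κ × σ) ℝ, aeval (fun v : κ × σ => u v.1 v.2) q =
      PowerSeries.constantCoeff (aeval w q) := by
    intro q
    let cc : PowerSeries A →ₐ[ℝ] A :=
      { (PowerSeries.constantCoeff : PowerSeries A →+* A) with
        commutes' := fun r => by
          change PowerSeries.constantCoeff (algebraMap ℝ (PowerSeries A) r) = _
          rw [IsScalarTower.algebraMap_apply ℝ A (PowerSeries A)]
          simp }
    have := MvPolynomial.comp_aeval_apply w cc q
    refine Eq.trans ?_ this.symm
    congr 2
    ext v
    exact (constantCoeff_expSeries D _ _).symm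
  rw [h3, h1, map_zero]

end Exp

theorem FormallySmooth.exists_ringHom_lift {R A B : Type*} [CommRing R] [CommRing A] [CommRing B]
    [Algebra R A] [Algebra.FormallySmooth R A] (φ : R →+* B) (g : B →+* A)
    (hg : Function.Surjective g) (hker : ∀ a b, g a = 0 → g b = 0 → a * b = 0)
    (hφ : ∀ r, g (φ r) = algebraMap R A r) :
    ∃ ψ : A →+* B, (∀ a, g (ψ a) = a) ∧ ∀ r, ψ (algebraMap R A r) = φ r := by
  let := φ.toAlgebra
  let g' : B →ₐ[R] A := { g with commutes' := hφ }
  have hnil : IsNilpotent (RingHom.ker (g' : B →+* A)) := by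
    refine ⟨2, ?_⟩
    rw [pow_two, Ideal.zero_eq_bot, eq_bot_iff, Ideal.mul_le]
    intro a ha b hb
    exact hker a b ha hb
  let ψ := Algebra.FormallySmooth.liftOfSurjective (AlgHom.id R A) g' hg hnil
  exact ⟨ψ, fun a => Algebra.FormallySmooth.liftOfSurjective_apply (AlgHom.id R A) g' hg hnil a,
    fun r => ψ.commutes r⟩

open scoped IntermediateField.algebraAdjoinAdjoin in
theorem exists_derivation_apply_ne_zero {F E : Type*} [Field F] [Field E] [CharZero F]
    [Algebra F E] {y : E} (hy : Transcendental F y) : ∃ δ : Derivation F E E, δ y ≠ 0 := by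
  classical
  have hy' : AlgebraicIndepOn F id ({y} : Set E) := by
    have : Unique ({y} : Set E) := Set.uniqueSingleton y
    refine algebraicIndependent_unique_type_iff.2 ?_
    have : (id ((default : ({y} : Set E)) : E)) = y := (default : ({y} : Set E)).2
    rwa [this]
  obtain ⟨s, hys, hs⟩ := exists_isTranscendenceBasis_superset hy'
  have halg : Algebra.IsAlgebraic (IntermediateField.adjoin F (Set.range ((↑) : s → E))) E :=
    hs.isAlgebraic_field
  have h1 : Algebra.FormallySmooth (Algebra.adjoin F (Set.range ((↑) : s → E)))
      (IntermediateField.adjoin F (Set.range ((↑) : s → E))) :=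
    .of_isLocalization (nonZeroDivisors _)
  have h2 : Algebra.FormallyEtale (IntermediateField.adjoin F (Set.range ((↑) : s → E))) E :=
    Algebra.FormallyEtale.of_isSeparable _ E
  have h3 : Algebra.FormallySmooth (Algebra.adjoin F (Set.range ((↑) : s → E))) E :=
    .comp _ (IntermediateField.adjoin F (Set.range ((↑) : s → E))) _
  let ev : MvPolynomial s F →ₐ[F] TrivSqZeroExt E E :=
    aeval fun t => TrivSqZeroExt.inl (t : E) + TrivSqZeroExt.inr (if (t : E) = y then 1 else 0)
  have hfst : ∀ p, TrivSqZeroExt.fstHom E E E (ev p) = aeval ((↑) : s → E) p := by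
    intro p
    have := MvPolynomial.comp_aeval_apply
      (fun t : s => (TrivSqZeroExt.inl (t : E) + TrivSqZeroExt.inr (if (t : E) = y then 1 else 0) :
        TrivSqZeroExt E E)) ((TrivSqZeroExt.fstHom E E E).restrictScalars F) p
    refine this.trans ?_
    congr 2
    ext t
    change TrivSqZeroExt.fst (_ + _) = _
    rw [TrivSqZeroExt.fst_add, TrivSqZeroExt.fst_inl, TrivSqZeroExt.fst_inr, add_zero]
  obtain ⟨ψ, hψ1, hψ2⟩ := FormallySmooth.exists_ringHom_lift
    (R := Algebra.adjoin F (Set.range ((↑) : s → E))) (A := E) (B := TrivSqZeroExt E E)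
    (ev.toRingHom.comp hs.1.aevalEquiv.symm.toRingEquiv.toRingHom)
    (TrivSqZeroExt.fstHom E E E).toRingHom (fun a => ⟨TrivSqZeroExt.inl a, rfl⟩)
    (by
      intro a b ha hb
      replace ha : a.fst = 0 := ha
      replace hb : b.fst = 0 := hb
      ext <;> simp [ha, hb])
    (by
      intro r
      obtain ⟨p, rfl⟩ := hs.1.aevalEquiv.surjective r
      refine Eq.trans (b := TrivSqZeroExt.fstHom E E E (ev p)) ?_ ?_
      · simp
      · rw [hfst]; simp)
  have hψF : ∀ c : F, ψ (algebraMap F E c) = TrivSqZeroExt.inl (algebraMap F E c) := by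
    intro c
    have := hψ2 (algebraMap F _ c)
    rw [← IsScalarTower.algebraMap_apply] at this
    rw [this]
    refine Eq.trans (b := ev (algebraMap F _ c)) ?_ ?_
    · simp
    · rw [AlgHom.commutes]; rfl
  have hfst' : ∀ a, (ψ a).fst = a := hψ1
  refine ⟨Derivation.mk' { toFun := fun a => (ψ a).snd, map_add' := ?_, map_smul' := ?_ } ?_, ?_⟩
  · intro a b; simp
  · intro c a
    simp [Algebra.smul_def, hψF]
  · intro a b
    simp [hfst', mul_comm (ψ a).snd]
  · change (ψ y).snd ≠ 0
    have h4 := hψ2 (hs.1.aevalEquiv (X ⟨y, hys rfl⟩))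
    have h5 : algebraMap (Algebra.adjoin F (Set.range ((↑) : s → E))) E
        (hs.1.aevalEquiv (X ⟨y, hys rfl⟩)) = y := by simp
    rw [h5] at h4
    have h6 : ψ y = ev (X ⟨y, hys rfl⟩) := by
      rw [h4]; simp
    rw [h6]
    simp [ev]

section Tame

variable {A : Type*} [CommRing A] [Algebra ℚ A] (D : Derivation ℚ A A)

theorem Derivation.apply_mem_adjoin {s : Set A} {B : Subalgebra ℚ A} (hs : s ⊆ B)
    (h : ∀ x ∈ s, D x ∈ B) : ∀ b ∈ Algebra.adjoin ℚ s, D b ∈ B := by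
  intro b hb
  induction hb using Algebra.adjoin_induction with
  | mem x hx => exact h x hx
  | algebraMap r => simp [B.zero_mem]
  | add x y _ _ hx hy => rw [map_add]; exact B.add_mem hx hy
  | mul x y hx' hy' hx hy =>
    have hle : Algebra.adjoin ℚ s ≤ B := Algebra.adjoin_le hs
    rw [Derivation.leibniz]
    exact B.add_mem (B.mul_mem (hle hx') hy) (B.mul_mem (hle hy') hx)

/-- `a` lies in a finitely generated subalgebra stable under `D`. -/
def Derivation.IsTame (a : A) : Prop :=
  ∃ B : Subalgebra ℚ A, B.FG ∧ (∀ b ∈ B, D b ∈ B) ∧ a ∈ B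

variable {D}

theorem Derivation.exists_stable_of_finite {s : Set A} (hs : s.Finite)
    (h : ∀ a ∈ s, D.IsTame a) :
    ∃ B : Subalgebra ℚ A, B.FG ∧ (∀ b ∈ B, D b ∈ B) ∧ s ⊆ B := by
  induction s, hs using Set.Finite.induction_on with
  | empty => exact ⟨⊥, Subalgebra.fg_bot, by
      intro b hb
      obtain ⟨r, rfl⟩ := Algebra.mem_bot.1 hb
      simp, by simp⟩
  | @insert a s _ _ ih =>
    obtain ⟨B, hB, hBD, hsB⟩ := ih fun b hb => h b (Or.inr hb)
    obtain ⟨B', hB', hBD', haB⟩ := h a (Or.inl rfl)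
    refine ⟨B ⊔ B', hB.sup hB', ?_, ?_⟩
    · refine Derivation.apply_mem_adjoin D Algebra.subset_adjoin ?_
      rintro x (hx | hx)
      · exact Algebra.mem_sup_left (hBD x hx)
      · exact Algebra.mem_sup_right (hBD' x hx)
    · rintro x (rfl | hx)
      · exact Algebra.mem_sup_right haB
      · exact Algebra.mem_sup_left (hsB hx)

theorem Derivation.IsTame.of_adjoin {B : Subalgebra ℚ A} (hB : B.FG) (hBD : ∀ b ∈ B, D b ∈ B)
    {s : Set A} (hs : s.Finite) (h : ∀ x ∈ s, D x ∈ B ⊔ Algebra.adjoin ℚ s) :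
    ∀ a ∈ B ⊔ Algebra.adjoin ℚ s, D.IsTame a := by
  intro a ha
  refine ⟨_, hB.sup (Subalgebra.fg_adjoin_finset hs.toFinset), ?_, ?_⟩
  · have hB' : B ⊔ Algebra.adjoin ℚ s = Algebra.adjoin ℚ (B ∪ s) := by
      rw [Algebra.adjoin_union, Algebra.adjoin_eq]
    rw [hs.coe_toFinset]
    rw [hB'] at h ⊢
    refine Derivation.apply_mem_adjoin D Algebra.subset_adjoin ?_
    rintro x (hx | hx)
    · exact Algebra.subset_adjoin (Or.inl (hBD x hx))
    · exact h x hx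
  · rwa [hs.coe_toFinset]

theorem Derivation.isTame_of_eq_zero {a : A} (ha : D a = 0) : D.IsTame a := by
  refine Derivation.IsTame.of_adjoin (s := {a}) Subalgebra.fg_bot ?_ (Set.finite_singleton a) ?_ a
    (Algebra.mem_sup_right (Algebra.subset_adjoin rfl))
  · intro b hb
    obtain ⟨r, rfl⟩ := Algebra.mem_bot.1 hb
    simp
  · rintro x rfl
    rw [ha]
    exact zero_mem _

theorem Derivation.IsTame.exists_pair {a b : A} (ha : D.IsTame a) (hb : D.IsTame b) :
    ∃ B : Subalgebra ℚ A, B.FG ∧ (∀ b ∈ B, D b ∈ B) ∧ a ∈ B ∧ b ∈ B := by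
  obtain ⟨B, hB, hBD, hs⟩ := Derivation.exists_stable_of_finite (D := D) (s := {a, b})
    (Set.toFinite _) (by rintro x (rfl | rfl) <;> assumption)
  exact ⟨B, hB, hBD, hs (by simp), hs (by simp)⟩

theorem Derivation.IsTame.add {a b : A} (ha : D.IsTame a) (hb : D.IsTame b) :
    D.IsTame (a + b) := by
  obtain ⟨B, hB, hBD, haB, hbB⟩ := ha.exists_pair hb
  exact ⟨B, hB, hBD, B.add_mem haB hbB⟩

theorem Derivation.IsTame.mul {a b : A} (ha : D.IsTame a) (hb : D.IsTame b) :
    D.IsTame (a * b) := by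
  obtain ⟨B, hB, hBD, haB, hbB⟩ := ha.exists_pair hb
  exact ⟨B, hB, hBD, B.mul_mem haB hbB⟩

theorem Derivation.IsTame.of_mul_eq_one {a b : A} (ha : D.IsTame a) (hab : b * a = 1) :
    D.IsTame b := by
  obtain ⟨B, hB, hBD, haB⟩ := ha
  refine Derivation.IsTame.of_adjoin (s := {b}) hB hBD (Set.finite_singleton b) ?_ b
    (Algebra.mem_sup_right (Algebra.subset_adjoin rfl))
  rintro x rfl
  have hx : x ∈ B ⊔ Algebra.adjoin ℚ {x} := Algebra.mem_sup_right (Algebra.subset_adjoin rfl)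
  rw [Derivation.leibniz_of_mul_eq_one _ hab, smul_eq_mul]
  exact mul_mem (neg_mem (pow_mem hx 2)) (Algebra.mem_sup_left (hBD _ haB))

theorem Derivation.apply_polynomial_eval (p : Polynomial A) (a : A) :
    D (p.eval a) = (p.sum fun n c => D c * a ^ n) + p.derivative.eval a * D a := by
  rw [Polynomial.eval_eq_sum, Polynomial.derivative_eval, Polynomial.sum, Polynomial.sum,
    Polynomial.sum, map_sum, Finset.sum_mul, ← Finset.sum_add_distrib]
  refine Finset.sum_congr rfl fun n _ => ?_
  rw [Derivation.leibniz, Derivation.leibniz_pow]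
  simp only [smul_eq_mul, nsmul_eq_mul]
  ring

theorem Derivation.IsTame.of_root {a z : A} (p : Polynomial A) (hp : ∀ i, D.IsTame (p.coeff i))
    (h : p.eval a = 0) (hz : z * p.derivative.eval a = 1) : D.IsTame a := by
  obtain ⟨B, hB, hBD, hpB⟩ := Derivation.exists_stable_of_finite (D := D)
    (s := p.coeff '' p.support) ((Finset.finite_toSet _).image _)
    (by rintro _ ⟨i, -, rfl⟩; exact hp i)
  set B' := B ⊔ Algebra.adjoin ℚ {a, z} with hB'
  have ha : a ∈ B' := Algebra.mem_sup_right (Algebra.subset_adjoin (by simp))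
  have hz' : z ∈ B' := Algebra.mem_sup_right (Algebra.subset_adjoin (by simp))
  have hBB : B ≤ B' := le_sup_left
  have hDa : D a ∈ B' := by
    have h1 := Derivation.apply_polynomial_eval (D := D) p a
    rw [h, map_zero] at h1
    have h2 : D a = - z * (p.sum fun n c => D c * a ^ n) := by
      linear_combination (- D a) * hz - z * h1
    rw [h2]
    refine mul_mem (neg_mem hz') (sum_mem fun n hn => mul_mem ?_ (pow_mem ha n))
    exact hBB (hBD _ (hpB ⟨n, hn, rfl⟩))
  have hle : Algebra.adjoin ℚ (B ∪ {a}) ≤ B' := Algebra.adjoin_le (by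
    rintro x (hx | rfl)
    exacts [hBB hx, ha])
  have hder : p.derivative.eval a ∈ Algebra.adjoin ℚ (B ∪ {a} : Set A) := by
    rw [Polynomial.derivative_eval]
    refine sum_mem fun n hn => mul_mem (mul_mem ?_ (natCast_mem _ n)) (pow_mem ?_ _)
    · exact Algebra.subset_adjoin (Or.inl (hpB ⟨n, hn, rfl⟩))
    · exact Algebra.subset_adjoin (Or.inr rfl)
  refine Derivation.IsTame.of_adjoin (s := {a, z}) hB hBD (Set.toFinite _) ?_ a ha
  rintro x (rfl | rfl)
  · exact hDa
  · rw [Derivation.leibniz_of_mul_eq_one _ hz, smul_eq_mul]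
    refine mul_mem (neg_mem (pow_mem hz' 2)) ?_
    refine Derivation.apply_mem_adjoin D (B := B') (s := B ∪ {a}) ?_ ?_ _ hder
    · exact fun x hx => hle (Algebra.subset_adjoin hx)
    · rintro x (hx | rfl)
      exacts [hBB (hBD x hx), hDa]

theorem Derivation.exists_system {σ : Type} [Finite σ] (w : σ → A) (h : ∀ j, D.IsTame (w j)) :
    ∃ (m : ℕ) (u : σ ⊕ Fin m → A) (P : σ ⊕ Fin m → MvPolynomial (σ ⊕ Fin m) ℚ),
      (∀ j, u (Sum.inl j) = w j) ∧ ∀ i, D (u i) = aeval u (P i) := by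
  obtain ⟨B, ⟨g, hg⟩, hBD, hwB⟩ := Derivation.exists_stable_of_finite (D := D)
    (Set.finite_range w) (by rintro _ ⟨j, rfl⟩; exact h j)
  let u : σ ⊕ Fin g.card → A := Sum.elim w fun i => (g.equivFin.symm i).1
  have hu : ∀ i, u i ∈ B := by
    rintro (j | i)
    · exact hwB ⟨j, rfl⟩
    · rw [← hg]
      exact Algebra.subset_adjoin (g.equivFin.symm i).2
  have hB : ∀ b ∈ B, ∃ p : MvPolynomial (σ ⊕ Fin g.card) ℚ, b = aeval u p := by
    intro b hb
    have : b ∈ Algebra.adjoin ℚ (Set.range u) := by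
      rw [← hg] at hb
      refine Algebra.adjoin_mono ?_ hb
      intro x hx
      exact ⟨Sum.inr (g.equivFin ⟨x, hx⟩), by simp [u]⟩
    rw [Algebra.adjoin_range_eq_range_aeval] at this
    obtain ⟨p, hp⟩ := this
    exact ⟨p, hp.symm⟩
  choose P hP using fun i => hB (D (u i)) (hBD _ (hu i))
  exact ⟨g.card, u, P, fun j => rfl, hP⟩

end Tame

section Universal

variable {F K : Type} [Field F] [Field K] [Algebra F K]

theorem exists_kaehler_basis : ∃ (T : Type) (t : T → K)
    (ℓ : Ω[K⁄F] →ₗ[K] MvPolynomial T K), Function.Injective ℓ ∧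
      (∀ τ, ℓ (KaehlerDifferential.D F K (t τ)) = X τ) ∧
      ∀ δ : Derivation F K K, (∀ τ, δ (t τ) = 0) → δ = 0 := by
  classical
  obtain ⟨T, t, -, hspan, hli⟩ := exists_linearIndependent' K
    (fun y : K => KaehlerDifferential.D F K y)
  have htop : ⊤ ≤ Submodule.span K (Set.range ((fun y : K => KaehlerDifferential.D F K y) ∘ t)) := by
    rw [hspan]
    exact (KaehlerDifferential.span_range_derivation F K).ge
  let β : Module.Basis T K Ω[K⁄F] := .mk hli htop
  have hβ : ∀ τ, β τ = KaehlerDifferential.D F K (t τ) := fun τ => by simp [β]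
  refine ⟨T, t, β.constr K fun τ => X τ, ?_, ?_, ?_⟩
  · exact β.injective_constr_of_linearIndependent (linearIndependent_X T K)
  · intro τ
    rw [← hβ, Module.Basis.constr_basis]
  · intro δ hδ
    have : δ.liftKaehlerDifferential = 0 := β.ext fun τ => by
      rw [hβ, Derivation.liftKaehlerDifferential_comp_D, hδ]; rfl
    rw [← δ.liftKaehlerDifferential_comp, this]
    ext; rfl

theorem exists_derivation_mvPolynomial (T : Type) (ℓ : Ω[K⁄F] →ₗ[K] MvPolynomial T K) :
    ∃ D : Derivation F (MvPolynomial T K) (MvPolynomial T K),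
      (∀ y, D (C y) = ℓ (KaehlerDifferential.D F K y)) ∧ ∀ τ, D (X τ) = 0 := by
  let δ : Derivation F K (MvPolynomial T K) := ℓ.compDer (KaehlerDifferential.D F K)
  let θ : K →+* TrivSqZeroExt (MvPolynomial T K) (MvPolynomial T K) :=
    { toFun := fun y => TrivSqZeroExt.inl (C y) + TrivSqZeroExt.inr (δ y)
      map_one' := by ext <;> simp
      map_mul' := fun a b => by ext <;> simp [MvPolynomial.smul_eq_C_mul, mul_comm]
      map_zero' := by ext <;> simp
      map_add' := fun a b => by ext <;> simp }
  let ψ : MvPolynomial T K →+* TrivSqZeroExt (MvPolynomial T K) (MvPolynomial T K) :=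
    eval₂Hom θ fun τ => TrivSqZeroExt.inl (X τ)
  have hC : ∀ y, ψ (C y) = TrivSqZeroExt.inl (C y) + TrivSqZeroExt.inr (δ y) := fun y =>
    eval₂Hom_C _ _ _
  have hX : ∀ τ, ψ (X τ) = TrivSqZeroExt.inl (X τ) := fun τ => eval₂Hom_X' _ _ _
  have hfst : ∀ a, (ψ a).fst = a := by
    intro a
    induction a using MvPolynomial.induction_on with
    | C y => rw [hC]; simp
    | add p q hp hq => simp [hp, hq]
    | mul_X p τ hp => simp [hp, hX]
  refine ⟨Derivation.mk' { toFun := fun a => (ψ a).snd, map_add' := ?_, map_smul' := ?_ } ?_,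
    ?_, ?_⟩
  · intro a b; simp
  · intro c a
    have h1 : c • a = C (algebraMap F K c) * a := by
      rw [Algebra.smul_def]; rfl
    rw [h1, map_mul, hC, Derivation.map_algebraMap]
    simp [Algebra.smul_def, MvPolynomial.algebraMap_apply]
  · intro a b
    simp [hfst, mul_comm (ψ a).snd]
  · intro y
    change (ψ (C y)).snd = _
    rw [hC]; simp [δ]
  · intro τ
    change (ψ (X τ)).snd = _
    rw [hX]; simp

theorem isAlgebraic_adjoin_of_derivation [CharZero F] {T : Type} (t : T → K)
    (h : ∀ δ : Derivation F K K, (∀ τ, δ (t τ) = 0) → δ = 0) (y : K) :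
    IsAlgebraic (IntermediateField.adjoin F (Set.range t)) y := by
  by_contra hy
  obtain ⟨δ, hδ⟩ := exists_derivation_apply_ne_zero hy
  apply hδ
  have := h (δ.restrictScalars F) fun τ => by
    have : t τ = algebraMap (IntermediateField.adjoin F (Set.range t)) K
      ⟨t τ, IntermediateField.subset_adjoin _ _ ⟨τ, rfl⟩⟩ := rfl
    rw [Derivation.restrictScalars_apply, this, Derivation.map_algebraMap]
  exact DFunLike.congr_fun this y

theorem exists_tame_derivation [CharZero F] [CharZero K]
    (hcl : ∀ y : K, IsAlgebraic F y → y ∈ Set.range (algebraMap F K)) :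
    ∃ (T : Type) (D : Derivation F (MvPolynomial T K) (MvPolynomial T K)),
      (∀ y, D (C y) = 0 → y ∈ Set.range (algebraMap F K)) ∧
      ∀ y, (D.restrictScalars ℚ).IsTame (C y) := by
  obtain ⟨T, t, ℓ, hℓ, hℓt, ht⟩ := exists_kaehler_basis (F := F) (K := K)
  obtain ⟨D, hDC, hDX⟩ := exists_derivation_mvPolynomial T ℓ
  refine ⟨T, D, ?_, ?_⟩
  · intro y hy
    refine hcl y ?_
    by_contra htr
    obtain ⟨δ, hδ⟩ := exists_derivation_apply_ne_zero htr
    apply hδ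
    have h1 : KaehlerDifferential.D F K y = 0 := hℓ (by rw [← hDC, hy, map_zero])
    rw [← δ.liftKaehlerDifferential_comp_D, h1, map_zero]
  have hmul : ∀ a b : K, (D.restrictScalars ℚ).IsTame (C a) → (D.restrictScalars ℚ).IsTame (C b) →
      (D.restrictScalars ℚ).IsTame (C (a * b)) := fun a b ha hb => by
    rw [map_mul]; exact ha.mul hb
  let E : IntermediateField F K :=
    { carrier := {y | (D.restrictScalars ℚ).IsTame (C y)}
      mul_mem' := fun {a b} ha hb => hmul a b ha hb
      add_mem' := fun {a b} ha hb => by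
        change (D.restrictScalars ℚ).IsTame (C (a + b))
        rw [map_add]; exact Derivation.IsTame.add ha hb
      algebraMap_mem' := fun c => by
        refine Derivation.isTame_of_eq_zero ?_
        exact D.map_algebraMap c
      inv_mem' := fun a ha => by
        by_cases h0 : a = 0
        · subst h0
          simpa using ha
        · refine Derivation.IsTame.of_mul_eq_one ha ?_
          rw [← map_mul, inv_mul_cancel₀ h0, map_one] }
  have hE : IntermediateField.adjoin F (Set.range t) ≤ E := by
    rw [IntermediateField.adjoin_le_iff]
    rintro _ ⟨τ, rfl⟩
    refine Derivation.IsTame.of_adjoin (B := ⊥) (s := {C (t τ), X τ}) Subalgebra.fg_bot ?_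
      (Set.toFinite _) ?_ _ (Algebra.mem_sup_right (Algebra.subset_adjoin (by simp)))
    · intro b hb
      obtain ⟨r, rfl⟩ := Algebra.mem_bot.1 hb
      rw [Derivation.map_algebraMap]
      exact zero_mem _
    · rintro x (rfl | rfl)
      · rw [Derivation.restrictScalars_apply, hDC, hℓt]
        exact Algebra.mem_sup_right (Algebra.subset_adjoin (by simp))
      · rw [Derivation.restrictScalars_apply, hDX]
        exact zero_mem _
  intro y
  have hy := (isAlgebraic_adjoin_of_derivation t ht y).isIntegral
  have hsep : (minpoly (IntermediateField.adjoin F (Set.range t)) y).Separable :=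
    (minpoly.irreducible hy).separable
  set p := (minpoly (IntermediateField.adjoin F (Set.range t)) y).map
    (algebraMap (IntermediateField.adjoin F (Set.range t)) K) with hp
  have hev : p.eval y = 0 := by
    rw [hp, Polynomial.eval_map_algebraMap, minpoly.aeval]
  have hder : p.derivative.eval y ≠ 0 := by
    rw [hp, Polynomial.derivative_map, Polynomial.eval_map_algebraMap]
    exact hsep.aeval_derivative_ne_zero (minpoly.aeval _ _)
  refine Derivation.IsTame.of_root (p.map (C : K →+* MvPolynomial T K))
    (z := C (p.derivative.eval y)⁻¹) ?_ ?_ ?_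
  · intro i
    rw [Polynomial.coeff_map, hp, Polynomial.coeff_map]
    exact hE ((minpoly (IntermediateField.adjoin F (Set.range t)) y).coeff i).2
  · rw [Polynomial.eval_map_apply, hev, map_zero]
  · rw [Polynomial.derivative_map (p := p), Polynomial.eval_map_apply, ← map_mul, inv_mul_cancel₀ hder,
      map_one]

end Universal

theorem mem_range_of_isAlgebraic_ultrapower {ι F K : Type} [Field F] [Field K] [Algebra F K]
    {U : Ultrafilter ι} {π : (ι → F) →ₐ[F] K} (hs : Function.Surjective π)
    (hπ : ∀ φ, π φ = 0 ↔ ∀ᶠ i in U, φ i = 0) (y : K) (hy : IsAlgebraic F y) :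
    y ∈ Set.range (algebraMap F K) := by
  obtain ⟨φ, rfl⟩ := hs y
  obtain ⟨p, hp0, hp⟩ := hy
  have h1 : ∀ᶠ i in U, φ i ∈ p.rootSet F := by
    have : π (Polynomial.aeval φ p) = 0 := by rw [← Polynomial.aeval_algHom_apply, hp]
    rw [hπ] at this
    filter_upwards [this] with i hi
    rw [Polynomial.mem_rootSet_of_ne hp0]
    have := Polynomial.aeval_algHom_apply (Pi.evalAlgHom F (fun _ : ι => F) i) φ p
    exact this.trans hi
  have h2 : ∃ c ∈ p.rootSet F, ∀ᶠ i in U, φ i = c := by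
    have h3 := (Ultrafilter.finite_biUnion_mem_iff (f := U) (p.rootSet_finite F)
      (s := fun c => {i | φ i = c})).1 (by
        filter_upwards [h1] with i hi
        simpa using hi)
    exact h3
  obtain ⟨c, -, hc⟩ := h2
  refine ⟨c, ?_⟩
  have : π (algebraMap F (ι → F) c - φ) = 0 := by
    rw [hπ]
    filter_upwards [hc] with i hi
    simp [hi]
  rw [map_sub, sub_eq_zero, AlgHom.commutes] at this
  exact this

theorem exists_germ_map {κ Lb σ : Type} [Finite Lb] [Finite σ] {d : ℕ}
    {e : κ → Fin (d + 1) → Lb} {S : Set (MvPolynomial (κ × σ) ℝ)} {r : MvPolynomial σ ℝ}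
    {J : Set σ} (H : ∀ M : ℕ, ∃ f : (Fin (d + 1) → Fin M) → σ → ℝ, IsGoodMap e S r J f)
    (X : Type) :
    ∃ (F K : Type) (_ : Field F) (_ : Field K) (_ : Algebra ℝ F) (_ : Algebra ℝ K)
      (_ : Algebra F K) (_ : IsScalarTower ℝ F K) (f : (Fin d → X) → σ → K),
      RealSpecializes K ∧ (∀ y : K, IsAlgebraic F y → y ∈ Set.range (algebraMap F K)) ∧
      (∀ a, ∃ j ∈ J, f a j ∉ Set.range (algebraMap F K)) ∧
      (∀ a, aeval (f a) r ≠ 0) ∧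
      (∀ a b, (∃ i, a i ≠ b i ∧ ∀ j, j ≠ i → a j = b j) → ∃ j ∈ J, f a j ≠ f b j) ∧
      ∀ (W : Type) [CommRing W] [Algebra F W] [Algebra ℝ W] [IsScalarTower ℝ F W]
        (E : Lb → K →ₐ[F] W) (h : Fin d → Lb → X), (∀ i, Function.Injective (h i)) →
        ∀ q ∈ S, aeval (fun v : κ × σ =>
          E (e v.1 (Fin.last d)) (f (fun i => h i (e v.1 i.castSucc)) v.2)) q = 0 := by
  obtain ⟨F, _, _, f, hF, hf⟩ := exists_isGoodMap_ultrapower H (X ⊕ ℕ)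
  obtain ⟨K, _, _, π, hs, hπ⟩ := exists_ultrapower F (Filter.hyperfilter ℕ)
  let _ : Algebra ℝ K := ((algebraMap F K).comp (algebraMap ℝ F)).toAlgebra
  have _ : IsScalarTower ℝ F K := .of_algebraMap_eq fun _ => rfl
  let pt : (Fin d → X) → ℕ → Fin (d + 1) → X ⊕ ℕ := fun a n =>
    Fin.snoc (α := fun _ => X ⊕ ℕ) (fun i => Sum.inl (a i)) (Sum.inr n)
  have hne : ∀ φ ψ : ℕ → F, (∀ᶠ i in (Filter.hyperfilter ℕ : Filter ℕ), φ i = ψ i) ↔ π φ = π ψ := by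
    intro φ ψ
    rw [← sub_eq_zero (a := π φ), ← map_sub, hπ]
    simp [sub_eq_zero]
  refine ⟨F, K, inferInstance, inferInstance, inferInstance, inferInstance, inferInstance,
    inferInstance, fun a j => π fun n => f (pt a n) j,
    RealSpecializes.ultrapower (π := π.restrictScalars ℝ) hs hπ hF,
    mem_range_of_isAlgebraic_ultrapower hs hπ, ?_, ?_, ?_, ?_⟩
  · intro a
    by_contra! hcon
    have h1 : ∀ j, ∃ c, j ∈ J → ∀ᶠ n in (Filter.hyperfilter ℕ : Filter ℕ), f (pt a n) j = c := by
      intro j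
      by_cases hj : j ∈ J
      · obtain ⟨c, hc⟩ := hcon j hj
        refine ⟨c, fun _ => ?_⟩
        have := (hne (fun n => f (pt a n) j) (algebraMap F (ℕ → F) c)).2 (by
          rw [← hc, AlgHom.commutes])
        simpa using this
      · exact ⟨0, fun h => absurd h hj⟩
    choose c hc using h1
    have h2 : ∀ᶠ n in (Filter.hyperfilter ℕ : Filter ℕ), ∀ j ∈ J, f (pt a n) j = c j := by
      rw [Filter.eventually_all]
      intro j
      by_cases hj : j ∈ J
      · filter_upwards [hc j hj] with n hn _ using hn
      · exact Filter.Eventually.of_forall fun n h => absurd h hj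
    obtain ⟨n, hn⟩ := h2.exists
    have h3 : ∀ᶠ m in (Filter.hyperfilter ℕ : Filter ℕ), m ≠ n := by
      have := Filter.hyperfilter_le_cofinite (α := ℕ) (Set.finite_singleton n).compl_mem_cofinite
      filter_upwards [this] with m hm using hm
    obtain ⟨m, hm, hmn⟩ := (h2.and h3).exists
    obtain ⟨j, hj, hj'⟩ := hf.sep (pt a m) (pt a n) ⟨Fin.last d, by simpa [pt] using hmn, by
      intro i hi
      induction i using Fin.lastCases with
      | last => exact absurd rfl hi
      | cast i => simp [pt]⟩
    exact hj' (by rw [hm j hj, hn j hj])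
  · intro a h
    have h1 := (aeval_ultrapower (R := ℝ) (π := π.restrictScalars ℝ) hπ
      (fun j n => f (pt a n) j) r).1 h
    obtain ⟨n, hn⟩ := h1.exists
    exact hf.ne_zero _ hn
  · rintro a b ⟨i, hi, hij⟩
    by_contra! hcon
    have h2 : ∀ᶠ n in (Filter.hyperfilter ℕ : Filter ℕ), ∀ j ∈ J, f (pt a n) j = f (pt b n) j := by
      rw [Filter.eventually_all]
      intro j
      by_cases hj : j ∈ J
      · filter_upwards [(hne _ _).2 (hcon j hj)] with n hn _ using hn
      · exact Filter.Eventually.of_forall fun n h => absurd h hj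
    obtain ⟨n, hn⟩ := h2.exists
    obtain ⟨j, hj, hj'⟩ := hf.sep (pt a n) (pt b n) ⟨i.castSucc, by simpa [pt] using hi, by
      intro i' hi'
      induction i' using Fin.lastCases with
      | last => simp [pt]
      | cast i' =>
        have : i' ≠ i := fun h => hi' (by rw [h])
        simp [pt, hij i' this]⟩
    exact hj' (hn j hj)
  · intro W _ _ _ _ E h hh q hq
    refine aeval_exp_eq_zero hπ E (fun v : κ × σ => e v.1 (Fin.last d))
      (fun v n => f (pt (fun i => h i (e v.1 i.castSucc)) n) v.2) q ?_
    intro b hb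
    have := hf.rel (fun i => Fin.lastCases (motive := fun _ => Lb → X ⊕ ℕ) (fun l => Sum.inr (b l))
      (fun i l => Sum.inl (h i l)) i) (by
        intro i
        induction i using Fin.lastCases with
        | last => exact fun x y hxy => hb (by simpa using hxy)
        | cast i => exact fun x y hxy => hh i (by simpa using hxy)) q hq
    rw [← this]
    congr 2
    ext v
    congr 1
    ext i
    induction i using Fin.lastCases with
    | last => simp [pt]
    | cast i => simp [pt]

/-- All iterated derivatives of the relations `S` along the flows of `P`. -/
def flowRelations {κ Lb σ τ : Type*} (L : κ → Lb) (P : σ ⊕ τ → MvPolynomial (σ ⊕ τ) ℝ)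
    (S : Set (MvPolynomial (κ × σ) ℝ)) : Set (MvPolynomial (κ × (σ ⊕ τ)) ℝ) :=
  {q' | ∃ (s : Lb → ℝ) (k : ℕ), ∃ q ∈ S,
    q' = (flowDerivation L P s)^[k] (rename (fun v => (v.1, Sum.inl v.2)) q)}

theorem exists_uniform_system {d : ℕ} {σ F K X : Type} [Finite σ] [Field F] [Field K] [CharZero F]
    [CharZero K] [Algebra F K] {J : Set σ}
    (hX : ∀ c : (Fin d → X) → ℕ, ∃ ι : Fin d → ℕ → X, (∀ i, Function.Injective (ι i)) ∧
      ∃ col, ∀ a : Fin d → ℕ, c (fun i => ι i (a i)) = col)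
    (hcl : ∀ y : K, IsAlgebraic F y → y ∈ Set.range (algebraMap F K))
    (f : (Fin d → X) → σ → K) (hf : ∀ a, ∃ j ∈ J, f a j ∉ Set.range (algebraMap F K)) :
    ∃ (ι : Fin d → ℕ → X) (T : Type) (D : Derivation F (MvPolynomial T K) (MvPolynomial T K))
      (m : ℕ) (P : σ ⊕ Fin m → MvPolynomial (σ ⊕ Fin m) ℚ), (∀ i, Function.Injective (ι i)) ∧
      ∃ j₀ ∈ J, ∀ a : Fin d → ℕ, ∃ u : σ ⊕ Fin m → MvPolynomial T K,
        (∀ j, u (Sum.inl j) = C (f (fun i => ι i (a i)) j)) ∧ (∀ i, D (u i) = aeval u (P i)) ∧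
        D (u (Sum.inl j₀)) ≠ 0 := by
  obtain ⟨T, D, hD, htame⟩ := exists_tame_derivation hcl
  have h1 : ∀ x : Fin d → X, ∃ c : Σ m : ℕ, σ × (σ ⊕ Fin m → MvPolynomial (σ ⊕ Fin m) ℚ),
      c.2.1 ∈ J ∧ ∃ u : σ ⊕ Fin c.1 → MvPolynomial T K,
        (∀ j, u (Sum.inl j) = C (f x j)) ∧ (∀ i, D (u i) = aeval u (c.2.2 i)) ∧
        D (u (Sum.inl c.2.1)) ≠ 0 := by
    intro x
    obtain ⟨j, hj, hj'⟩ := hf x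
    obtain ⟨m, u, P, hu, hP⟩ := Derivation.exists_system (D := D.restrictScalars ℚ)
      (fun j => C (f x j)) fun j => htame _
    refine ⟨⟨m, j, P⟩, hj, u, hu, hP, fun h0 => hj' (hD _ ?_)⟩
    rw [← hu]; exact h0
  choose c hc using h1
  have hcount : ∀ m : ℕ, Countable (MvPolynomial (σ ⊕ Fin m) ℚ) := fun m =>
    (basisMonomials (σ ⊕ Fin m) ℚ).repr.injective.countable
  obtain ⟨γ, hγ⟩ := exists_injective_nat
    (Σ m : ℕ, σ × (σ ⊕ Fin m → MvPolynomial (σ ⊕ Fin m) ℚ))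
  obtain ⟨ι, hι, col, hcol⟩ := hX fun x => γ (c x)
  have h2 : ∀ a : Fin d → ℕ, c (fun i => ι i (a i)) = c (fun i => ι i 0) := fun a =>
    hγ ((hcol a).trans (hcol 0).symm)
  refine ⟨ι, T, D, _, (c fun i => ι i 0).2.2, hι, (c fun i => ι i 0).2.1, (hc _).1, fun a => ?_⟩
  have := (hc fun i => ι i (a i)).2
  rwa [h2] at this

theorem exists_isGoodMap_flowRelations {κ Lb σ : Type} [Finite Lb] [Finite σ] {d : ℕ}
    {e : κ → Fin (d + 1) → Lb} {S : Set (MvPolynomial (κ × σ) ℝ)} {r : MvPolynomial σ ℝ}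
    {J : Set σ} (H : ∀ M : ℕ, ∃ f : (Fin (d + 1) → Fin M) → σ → ℝ, IsGoodMap e S r J f) :
    ∃ (m : ℕ) (P : σ ⊕ Fin m → MvPolynomial (σ ⊕ Fin m) ℝ), ∃ j₀ ∈ J, ∀ M : ℕ,
      ∃ f : (Fin d → Fin M) → σ ⊕ Fin m → ℝ, IsGoodMap (fun x i => e x i.castSucc)
        (flowRelations (fun x => e x (Fin.last d)) P S)
        (rename Sum.inl r * P (Sum.inl j₀)) (Sum.inl '' J) f := by
  classical
  obtain ⟨Z, hZ⟩ := exists_polarized d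
  obtain ⟨F, K, _, _, _, _, _, _, f, hK, hcl, hlast, hr, hsep, hrel⟩ := exists_germ_map H Z
  have _ : CharZero F := charZero_of_injective_algebraMap (algebraMap ℝ F).injective
  have _ : CharZero K := charZero_of_injective_algebraMap (algebraMap ℝ K).injective
  obtain ⟨ι, T, D, m, P, hι, j₀, hj₀, hu⟩ := exists_uniform_system hZ hcl f hlast
  choose u hu1 hu2 hu3 using hu
  let PR : σ ⊕ Fin m → MvPolynomial (σ ⊕ Fin m) ℝ := fun i => map (algebraMap ℚ ℝ) (P i)
  have hu2' : ∀ a i, D (u a i) = aeval (u a) (PR i) := fun a i => by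
    rw [hu2, aeval_map_algebraMap]
  refine ⟨m, PR, j₀, hj₀, fun M => ?_⟩
  let nv : (Fin d → Fin M) → Fin d → ℕ := fun a i => a i
  have hj : ∀ a b : Fin d → Fin M, ∃ j, (∃ i, a i ≠ b i ∧ ∀ j, j ≠ i → a j = b j) →
      j ∈ J ∧ u (nv a) (Sum.inl j) ≠ u (nv b) (Sum.inl j) := by
    intro a b
    by_cases hab : ∃ i, a i ≠ b i ∧ ∀ j, j ≠ i → a j = b j
    · obtain ⟨i, hi, hij⟩ := hab
      obtain ⟨j, hj, hne⟩ := hsep (fun i => ι i (nv a i)) (fun i => ι i (nv b i))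
        ⟨i, fun h => hi (Fin.ext (hι i h)), fun j hj => by simp only [nv, hij j hj]⟩
      refine ⟨j, fun _ => ⟨hj, ?_⟩⟩
      rw [hu1, hu1]
      exact fun h => hne (C_injective _ _ h)
    · exact ⟨j₀, fun h => absurd h hab⟩
  choose j hj using hj
  have hr' : ∀ a, aeval (u a) (rename Sum.inl r * PR (Sum.inl j₀)) ≠ 0 := by
    intro a
    rw [map_mul, ← hu2', aeval_rename]
    refine mul_ne_zero ?_ (hu3 a)
    have h1 : u a ∘ Sum.inl = algebraMap K (MvPolynomial T K) ∘ f (fun i => ι i (a i)) :=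
      funext (hu1 a)
    rw [h1, MvPolynomial.aeval_algebraMap_apply]
    exact fun h => hr _ (C_injective _ _ (h.trans (map_zero _).symm))
  let R : MvPolynomial ((Fin d → Fin M) × (σ ⊕ Fin m)) ℝ :=
    (∏ a : Fin d → Fin M, rename (fun i => (a, i)) (rename Sum.inl r * PR (Sum.inl j₀))) *
      ∏ a : Fin d → Fin M, ∏ b : Fin d → Fin M, if (∃ i, a i ≠ b i ∧ ∀ j, j ≠ i → a j = b j) then
        X (a, Sum.inl (j a b)) - X (b, Sum.inl (j a b)) else 1
  obtain ⟨w, hw, hwq⟩ := hK.mvPolynomial T _ (fun v : (Fin d → Fin M) × (σ ⊕ Fin m) => u (nv v.1) v.2)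
    R (by
      simp only [R]
      rw [map_mul, map_prod, map_prod]
      refine mul_ne_zero (Finset.prod_ne_zero_iff.2 fun a _ => ?_)
        (Finset.prod_ne_zero_iff.2 fun a _ => ?_)
      · rw [aeval_rename]
        exact hr' (nv a)
      · rw [map_prod]
        refine Finset.prod_ne_zero_iff.2 fun b _ => ?_
        split_ifs with hab
        · rw [map_sub, aeval_X, aeval_X, sub_ne_zero]
          exact (hj a b hab).2
        · simp)
  simp only [R, map_mul, map_prod] at hw
  obtain ⟨hw1, hw2⟩ := mul_ne_zero_iff.1 hw
  refine ⟨fun a i => w (a, i), ?_, ?_, ?_⟩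
  · rintro h hh _ ⟨s, k, q, hq, rfl⟩
    have h1 := hwq (rename (fun v : κ × (σ ⊕ Fin m) => ((fun i => h i (e v.1 i.castSucc)), v.2))
      ((flowDerivation (fun x => e x (Fin.last d)) PR s)^[k]
        (rename (fun v => (v.1, Sum.inl v.2)) q))) (by
      rw [aeval_rename]
      refine aeval_iterate_flowDerivation (fun x => e x (Fin.last d)) PR s D
        (fun x => u (nv fun i => h i (e x i.castSucc))) (fun x i => hu2' _ i) _ ?_ k
      rw [aeval_rename]
      have := hrel (PowerSeries (MvPolynomial T K))
        (fun l => (expSeriesHom D (s l)).comp (IsScalarTower.toAlgHom F K (MvPolynomial T K)))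
        (fun i l => ι i (h i l)) (fun i => (hι i).comp (Fin.val_injective.comp (hh i))) q hq
      refine Eq.trans ?_ this
      congr 2
      ext1 v
      simp only [Function.comp_apply, hu1]
      rfl)
    rw [aeval_rename] at h1
    exact h1
  · intro a
    have := Finset.prod_ne_zero_iff.1 hw1 a (Finset.mem_univ a)
    rw [← map_mul, ← map_mul, aeval_rename] at this
    exact this
  · intro a b hab
    have := Finset.prod_ne_zero_iff.1 (Finset.prod_ne_zero_iff.1 hw2 a (Finset.mem_univ a)) b
      (Finset.mem_univ b)
    rw [if_pos hab, map_sub, aeval_X, aeval_X, sub_ne_zero] at this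
    exact ⟨_, ⟨_, (hj a b hab).1, rfl⟩, this⟩

open scoped NNReal Topology in
theorem exists_local_flow {E : Type*} [NormedAddCommGroup E] [NormedSpace ℝ E] [CompleteSpace E]
    {V : E → E} {x₀ : E} (hV : ContDiffAt ℝ 1 V x₀) :
    ∃ (Φ : E → ℝ → E) (ρ : ℝ), 0 < ρ ∧
      (∀ x ∈ Metric.ball x₀ ρ, Φ x 0 = x ∧ ∀ t, |t| < ρ → HasDerivAt (Φ x) (V (Φ x t)) t) ∧
      HasStrictFDerivAt (fun p : E × ℝ => Φ p.1 p.2) (ContinuousLinearMap.fst ℝ E ℝ +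
        (ContinuousLinearMap.snd ℝ E ℝ).smulRight (V x₀)) (x₀, 0) := by
  obtain ⟨ε, hε, a, r, L, K, hr, hpl⟩ := IsPicardLindelof.of_contDiffAt_one hV
  obtain ⟨Φ, hΦ, L', hL'⟩ :=
    (hpl 0).exists_forall_mem_closedBall_eq_hasDerivWithinAt_lipschitzOnWith
  simp only [zero_sub, zero_add] at hΦ hL'
  have hΦ0 : ∀ x ∈ Metric.closedBall x₀ r, Φ x 0 = x := fun x hx => (hΦ x hx).1
  have hΦd : ∀ x ∈ Metric.closedBall x₀ r, ∀ t, |t| < ε → HasDerivAt (Φ x) (V (Φ x t)) t := by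
    intro x hx t ht
    rw [abs_lt] at ht
    exact ((hΦ x hx).2 t ⟨ht.1.le, ht.2.le⟩).hasDerivAt (Icc_mem_nhds ht.1 ht.2)
  have hcont : ContinuousOn (Function.uncurry Φ) (Metric.closedBall x₀ r ×ˢ Set.Icc (-ε) ε) :=
    continuousOn_prod_of_continuousOn_lipschitzOnWith _ L'
      (fun x hx => HasDerivWithinAt.continuousOn (hΦ x hx).2) hL'
  have hcontAt : ContinuousAt (Function.uncurry Φ) (x₀, 0) :=
    hcont.continuousAt (prod_mem_nhds (Metric.closedBall_mem_nhds _ hr)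
      (Icc_mem_nhds (by linarith) hε))
  have hx₀ : Function.uncurry Φ (x₀, 0) = x₀ :=
    hΦ0 x₀ (Metric.mem_closedBall_self hr.le)
  obtain ⟨K', s, hs, hK'⟩ := hV.exists_lipschitzOnWith
  have hrpos : (0 : ℝ) < r := hr
  refine ⟨Φ, min r ε, lt_min hr hε, fun x hx => ?_, ?_⟩
  · have hx' : x ∈ Metric.closedBall x₀ r :=
      Metric.ball_subset_closedBall (Metric.ball_subset_ball (min_le_left _ _) hx)
    exact ⟨hΦ0 x hx', fun t ht => hΦd x hx' t (ht.trans_le (min_le_right _ _))⟩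
  · rw [hasStrictFDerivAt_iff_isLittleO, Asymptotics.isLittleO_iff]
    intro c hc
    have h1 : ∀ᶠ p : E × ℝ in 𝓝 (x₀, 0), ‖V (Φ p.1 p.2) - V x₀‖ ≤ c / 2 ∧ Φ p.1 p.2 ∈ s := by
      have hVc : ContinuousAt (fun p : E × ℝ => V (Function.uncurry Φ p)) (x₀, 0) :=
        ContinuousAt.comp (g := V) (by rw [hx₀]; exact hV.continuousAt) hcontAt
      have h2 := (hVc.tendsto.sub_const (V x₀)).norm
      rw [hx₀, sub_self, norm_zero] at h2
      have h3 : Filter.Tendsto (Function.uncurry Φ) (𝓝 (x₀, 0)) (𝓝 x₀) := by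
        have := hcontAt.tendsto
        rwa [hx₀] at this
      filter_upwards [h2.eventually (ge_mem_nhds (half_pos hc)), h3.eventually hs] with p hp hp'
      exact ⟨hp, hp'⟩
    rw [Metric.eventually_nhds_iff_ball] at h1
    obtain ⟨η, hη, h1⟩ := h1
    set δ := min (min η ε) (min r (c / 2 / (K' * L' + 1))) with hδ
    have hKL : (0 : ℝ) < K' * L' + 1 := by positivity
    have hδpos : 0 < δ := by
      refine lt_min (lt_min hη hε) (lt_min hr (by positivity))
    have hδη : δ ≤ η := (min_le_left _ _).trans (min_le_left _ _)
    have hδε : δ ≤ ε := (min_le_left _ _).trans (min_le_right _ _)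
    have hδr : δ ≤ r := (min_le_right _ _).trans (min_le_left _ _)
    have hδc : δ ≤ c / 2 / (K' * L' + 1) := (min_le_right _ _).trans (min_le_right _ _)
    have hnear : ∀ x ∈ Metric.ball x₀ δ, ∀ t, |t| < δ → x ∈ Metric.closedBall x₀ r ∧ |t| < ε ∧
        ‖V (Φ x t) - V x₀‖ ≤ c / 2 ∧ Φ x t ∈ s := by
      intro x hx t ht
      refine ⟨Metric.ball_subset_closedBall (Metric.ball_subset_ball hδr hx), ht.trans_le hδε,
        h1 (x, t) ?_⟩
      rw [← ball_prod_same]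
      exact ⟨Metric.ball_subset_ball hδη hx, by simpa using ht.trans_le hδη⟩
    have hball : ∀ t : ℝ, t ∈ Metric.ball (0 : ℝ) δ ↔ |t| < δ := fun t => by simp
    have hfirst : ∀ x ∈ Metric.ball x₀ δ, ∀ t u, |t| < δ → |u| < δ →
        ‖Φ x t - Φ x u - (t - u) • V x₀‖ ≤ c / 2 * |t - u| := by
      intro x hx t u ht hu
      have := Convex.norm_image_sub_le_of_norm_hasDerivWithin_le
        (f := fun τ => Φ x τ - τ • V x₀) (f' := fun τ => V (Φ x τ) - (1 : ℝ) • V x₀) (C := c / 2)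
        (s := Metric.ball 0 δ) (x := u) (y := t) ?_ ?_ (convex_ball _ _) ((hball u).2 hu)
        ((hball t).2 ht)
      · rw [Real.norm_eq_abs] at this
        convert this using 2
        rw [sub_smul]; abel
      · intro τ hτ
        obtain ⟨h2, h3, -⟩ := hnear x hx τ ((hball τ).1 hτ)
        exact ((hΦd x h2 τ h3).sub ((hasDerivAt_id τ).smul_const (V x₀))).hasDerivWithinAt
      · intro τ hτ
        rw [one_smul]
        exact (hnear x hx τ ((hball τ).1 hτ)).2.2.1
    have hsecond : ∀ x ∈ Metric.ball x₀ δ, ∀ y ∈ Metric.ball x₀ δ, ∀ u, |u| < δ →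
        ‖Φ x u - Φ y u - (x - y)‖ ≤ c / 2 * ‖x - y‖ := by
      intro x hx y hy u hu
      have := Convex.norm_image_sub_le_of_norm_hasDerivWithin_le
        (f := fun τ => Φ x τ - Φ y τ) (f' := fun τ => V (Φ x τ) - V (Φ y τ))
        (C := K' * (L' * ‖x - y‖))
        (s := Metric.ball 0 δ) (x := 0) (y := u) ?_ ?_ (convex_ball _ _)
        (Metric.mem_ball_self hδpos) ((hball u).2 hu)
      · rw [Real.norm_eq_abs, sub_zero, hΦ0 x (hnear x hx u hu).1, hΦ0 y (hnear y hy u hu).1]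
          at this
        refine this.trans ?_
        have h4 : (K' * L' : ℝ) * |u| ≤ c / 2 := by
          have h5 : |u| ≤ c / 2 / (K' * L' + 1) := hu.le.trans hδc
          rw [le_div_iff₀ hKL] at h5
          nlinarith [abs_nonneg u]
        nlinarith [norm_nonneg (x - y)]
      · intro τ hτ
        obtain ⟨h2, h3, -⟩ := hnear x hx τ ((hball τ).1 hτ)
        obtain ⟨h4, h5, -⟩ := hnear y hy τ ((hball τ).1 hτ)
        exact ((hΦd x h2 τ h3).sub (hΦd y h4 τ h5)).hasDerivWithinAt
      · intro τ hτ
        obtain ⟨h2, h3, -, h4⟩ := hnear x hx τ ((hball τ).1 hτ)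
        obtain ⟨h5, h6, -, h7⟩ := hnear y hy τ ((hball τ).1 hτ)
        refine (hK'.norm_sub_le h4 h7).trans ?_
        rw [abs_lt] at h3
        gcongr
        exact (hL' τ ⟨h3.1.le, h3.2.le⟩).norm_sub_le h2 h5
    rw [nhds_prod_eq]
    have hb : Metric.ball (x₀, (0 : ℝ)) δ ∈ 𝓝 (x₀, (0 : ℝ)) := Metric.ball_mem_nhds _ hδpos
    filter_upwards [Filter.prod_mem_prod hb hb] with ⟨⟨x, t⟩, ⟨y, u⟩⟩ ⟨hxt, hyu⟩
    simp only [← ball_prod_same] at hxt hyu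
    have hA := hfirst x hxt.1 t u ((hball t).1 hxt.2) ((hball u).1 hyu.2)
    have hB := hsecond x hxt.1 y hyu.1 u ((hball u).1 hyu.2)
    have hle1 : |t - u| ≤ ‖((x, t) - (y, u) : E × ℝ)‖ := by
      rw [← Real.norm_eq_abs]; exact norm_snd_le ((x, t) - (y, u) : E × ℝ)
    have hle2 : ‖x - y‖ ≤ ‖((x, t) - (y, u) : E × ℝ)‖ := norm_fst_le ((x, t) - (y, u) : E × ℝ)
    have heq : Φ x t - Φ y u - (ContinuousLinearMap.fst ℝ E ℝ +
        (ContinuousLinearMap.snd ℝ E ℝ).smulRight (V x₀)) ((x, t) - (y, u)) =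
        (Φ x t - Φ x u - (t - u) • V x₀) + (Φ x u - Φ y u - (x - y)) := by
      simp; abel
    change ‖Φ x t - Φ y u - _‖ ≤ _
    rw [heq]
    refine (norm_add_le _ _).trans ?_
    nlinarith

theorem hasDerivAt_aeval {N : Type*} (Pv : N → MvPolynomial N ℝ) {c : ℝ → N → ℝ} {t : ℝ}
    (hc : ∀ v, HasDerivAt (fun τ => c τ v) (aeval (c t) (Pv v)) t) (q : MvPolynomial N ℝ) :
    HasDerivAt (fun τ => aeval (c τ) q) (aeval (c t) (mkDerivation ℝ Pv q)) t := by
  induction q using MvPolynomial.induction_on with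
  | C a => simpa using hasDerivAt_const t a
  | add p q hp hq => simp only [map_add]; exact hp.fun_add hq
  | mul_X p v hp =>
    simp only [map_mul, aeval_X, Derivation.leibniz, smul_eq_mul, map_add, mkDerivation_X]
    exact (hp.fun_mul (hc v)).congr_deriv (by ring)

theorem aeval_eq_zero_of_iterate_mkDerivation {N : Type*} [Finite N] (Pv : N → MvPolynomial N ℝ)
    {c : ℝ → N → ℝ}
    (hc : ∀ t ∈ Set.Icc (0 : ℝ) 1, ∀ v, HasDerivAt (fun τ => c τ v) (aeval (c t) (Pv v)) t)
    (q : MvPolynomial N ℝ) (hq : ∀ k : ℕ, aeval (c 0) ((mkDerivation ℝ Pv)^[k] q) = 0) :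
    ∀ t ∈ Set.Icc (0 : ℝ) 1, aeval (c t) q = 0 := by
  classical
  set Δ := mkDerivation ℝ Pv with hΔ
  set I : Ideal (MvPolynomial N ℝ) := Ideal.span (Set.range fun k : ℕ => Δ^[k] q) with hI
  have hker : ∀ p ∈ I, aeval (c 0) p = 0 := by
    have hle : I ≤ RingHom.ker (aeval (R := ℝ) (c 0)) := by
      rw [hI, Ideal.span_le]
      rintro _ ⟨k, rfl⟩
      exact hq k
    exact fun p hp => hle hp
  have hstable : ∀ p ∈ I, Δ p ∈ I := by
    intro p hp
    induction hp using Submodule.span_induction with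
    | mem x hx =>
      obtain ⟨k, rfl⟩ := hx
      refine Ideal.subset_span ⟨k + 1, ?_⟩
      simp only [Function.iterate_succ_apply']
    | zero => simp
    | add x y _ _ hx hy => rw [map_add]; exact I.add_mem hx hy
    | smul a x hx' hx =>
      rw [smul_eq_mul, Derivation.leibniz]
      exact I.add_mem (I.mul_mem_left a hx) (by
        rw [smul_eq_mul]; exact I.mul_mem_right _ hx')
  obtain ⟨G, hG⟩ : I.FG := IsNoetherian.noetherian I
  have hGI : ∀ g ∈ G, g ∈ I := fun g hg => by
    rw [← hG]; exact Submodule.subset_span hg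
  have hcoef : ∀ p ∈ I, ∃ a : MvPolynomial N ℝ → MvPolynomial N ℝ, ∑ g : G, a g * g = p := by
    intro p hp
    rw [← hG, Submodule.mem_span_finset] at hp
    obtain ⟨a, -, ha⟩ := hp
    refine ⟨a, ?_⟩
    rw [← ha, Finset.sum_coe_sort G fun g => a g * g]
    rfl
  choose! A hA using fun p (hp : p ∈ I) => hcoef p hp
  have hcont : ∀ p : MvPolynomial N ℝ, ContinuousOn (fun τ => aeval (c τ) p) (Set.Icc 0 1) :=
    fun p t ht => (hasDerivAt_aeval Pv (hc t ht) p).continuousAt.continuousWithinAt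
  have hbound : ∃ K : ℝ, 0 ≤ K ∧ ∀ t ∈ Set.Icc (0 : ℝ) 1, ∀ g g' : G,
      |aeval (c t) (A (Δ g) g')| ≤ K := by
    have h1 : ∀ x : G × G, ∃ K : ℝ, ∀ t ∈ Set.Icc (0 : ℝ) 1,
        |aeval (c t) (A (Δ x.1) x.2)| ≤ K := fun x =>
      isCompact_Icc.exists_bound_of_continuousOn (hcont (A (Δ x.1) x.2))
    choose K hK using h1
    refine ⟨∑ x, |K x|, Finset.sum_nonneg fun x _ => abs_nonneg _, fun t ht g g' => (hK (g, g') t ht).trans ((le_abs_self _).trans ?_)⟩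
    exact Finset.single_le_sum (f := fun x => |K x|) (fun x _ => abs_nonneg _)
      (Finset.mem_univ (g, g'))
  obtain ⟨K, hK0, hK⟩ := hbound
  have hzero := eq_zero_of_abs_deriv_le_mul_abs_self_of_eq_zero_right
    (f := fun t (g : G) => aeval (c t) (g : MvPolynomial N ℝ))
    (f' := fun t (g : G) => aeval (c t) (Δ g)) (K := Fintype.card G * K) (a := 0) (b := 1)
    (continuousOn_pi.2 fun g => hcont g)
    (fun t ht => (hasDerivAt_pi.2 fun g : G =>
      hasDerivAt_aeval Pv (hc t ⟨ht.1, ht.2.le⟩) g).hasDerivWithinAt)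
    (funext fun g => hker g (hGI g g.2))
    (by
      intro t ht
      have ht' : t ∈ Set.Icc (0 : ℝ) 1 := ⟨ht.1, ht.2.le⟩
      have hKf : ∀ g g' : G, |aeval (c t) (A (Δ g) g')| ≤ K := hK t ht'
      refine (pi_norm_le_iff_of_nonneg (by positivity)).2 fun g => ?_
      have hgg : aeval (c t) (Δ g) = ∑ g' : G, aeval (c t) (A (Δ g) g') *
          aeval (c t) (g' : MvPolynomial N ℝ) := by
        conv_lhs => rw [← hA (Δ g) (hstable _ (hGI g g.2))]
        simp only [map_sum, map_mul]
      rw [hgg]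
      refine (norm_sum_le _ _).trans ((Finset.sum_le_sum (g := fun _ =>
        K * ‖fun g : G => aeval (c t) (g : MvPolynomial N ℝ)‖) fun g' _ => ?_).trans_eq ?_)
      · rw [norm_mul, Real.norm_eq_abs]
        exact mul_le_mul (hKf g g')
          (norm_le_pi_norm (fun g : G => aeval (c t) (g : MvPolynomial N ℝ)) g')
          (norm_nonneg _) hK0
      · rw [Finset.sum_const, Finset.card_univ, nsmul_eq_mul, mul_assoc])
  intro t ht
  have h2 : q ∈ I := Ideal.subset_span ⟨0, rfl⟩
  rw [← hA q h2, map_sum]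
  refine Finset.sum_eq_zero fun g _ => ?_
  rw [map_mul, congrFun (hzero t ht) g, Pi.zero_apply, mul_zero]

theorem IsSmoothModel.of_flowRelations {κ Lb σ τ : Type*} [Finite κ] [Finite Lb] [Fintype σ]
    [Fintype τ] {d : ℕ} {e : κ → Fin (d + 1) → Lb} {S : Set (MvPolynomial (κ × σ) ℝ)}
    {r : MvPolynomial σ ℝ} {J : Set σ} {P : σ ⊕ τ → MvPolynomial (σ ⊕ τ) ℝ} {j₀ : σ}
    (hj₀ : j₀ ∈ J) {g : (Fin d → ℝ) → σ ⊕ τ → ℝ} {g' : (Fin d → ℝ) →L[ℝ] (σ ⊕ τ → ℝ)}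
    (hg : IsSmoothModel (fun x i => e x i.castSucc)
      (flowRelations (fun x => e x (Fin.last d)) P S) (rename Sum.inl r * P (Sum.inl j₀))
      (Sum.inl '' J) g g') :
    ∃ G G', IsSmoothModel e S r J G G' := by
  set V : (σ ⊕ τ → ℝ) → σ ⊕ τ → ℝ := fun x i => aeval x (P i) with hVdef
  have hV : ContDiffAt ℝ 1 V (g 0) := by
    refine contDiffAt_pi.2 fun i => ?_
    exact (AnalyticOnNhd.eval_mvPolynomial (P i) (g 0) (Set.mem_univ _)).contDiffAt
  obtain ⟨Φ, ρ, hρ, hΦ, hΦ'⟩ := exists_local_flow hV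
  obtain ⟨ρ₁, hρ₁, hrel⟩ := hg.rel
  have hne := hg.ne_zero
  rw [map_mul, aeval_rename] at hne
  let ini : (Fin (d + 1) → ℝ) →L[ℝ] (Fin d → ℝ) :=
    ContinuousLinearMap.pi fun i => ContinuousLinearMap.proj i.castSucc
  let las : (Fin (d + 1) → ℝ) →L[ℝ] ℝ := ContinuousLinearMap.proj (Fin.last d)
  let pr : (σ ⊕ τ → ℝ) →L[ℝ] (σ → ℝ) :=
    ContinuousLinearMap.pi fun j => ContinuousLinearMap.proj (Sum.inl j)
  have hgi : HasStrictFDerivAt (fun t => g (ini t)) (g'.comp ini) 0 := by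
    have : HasStrictFDerivAt g g' (ini 0) := by rw [map_zero]; exact hg.deriv
    exact this.comp 0 ini.hasStrictFDerivAt
  have hpair := hgi.prodMk las.hasStrictFDerivAt
  have hflow : HasStrictFDerivAt (fun t => Φ (g (ini t)) (las t)) _ 0 :=
    HasStrictFDerivAt.comp (g := fun p : (σ ⊕ τ → ℝ) × ℝ => Φ p.1 p.2)
      (f := fun t => (g (ini t), las t)) 0
      (by simp only [map_zero]; exact hΦ') hpair
  have hfull := pr.hasStrictFDerivAt.comp 0 hflow
  have h0 : Φ (g 0) 0 = g 0 := (hΦ _ (Metric.mem_ball_self hρ)).1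
  refine ⟨_, _, hfull, ?_, ?_, ?_⟩
  · have : pr (Φ (g (ini 0)) (las 0)) = g 0 ∘ Sum.inl := by
      funext j
      simp only [map_zero, h0]
      rfl
    rw [this]
    exact left_ne_zero_of_mul hne
  · refine Fin.lastCases ⟨j₀, hj₀, ?_⟩ fun i => ?_
    · have h1 : ini (Pi.single (Fin.last d) 1) = 0 := by
        funext i
        simp [ini, Fin.ext_iff, i.2.ne]
      have h2 : las (Pi.single (Fin.last d) 1) = 1 := by simp [las]
      simp only [ContinuousLinearMap.comp_apply, ContinuousLinearMap.prod_apply, h1, h2]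
      simpa [pr, hVdef] using right_ne_zero_of_mul hne
    · obtain ⟨_, ⟨j, hj, rfl⟩, h⟩ := hg.deriv_ne i
      refine ⟨j, hj, ?_⟩
      have h1 : ini (Pi.single i.castSucc 1) = Pi.single i 1 := by
        funext l
        simp [ini, Pi.single_apply]
      have h2 : las (Pi.single i.castSucc 1) = 0 := by
        simp [las, Fin.ext_iff, i.2.ne']
      simp only [ContinuousLinearMap.comp_apply, ContinuousLinearMap.prod_apply, h1, h2]
      simpa [pr] using h
  · have hcont : ContinuousAt g 0 := hg.deriv.continuousAt
    obtain ⟨ρ₂, hρ₂, hball⟩ := Metric.mem_nhds_iff.1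
      (hcont.preimage_mem_nhds (Metric.ball_mem_nhds _ hρ))
    refine ⟨min ρ (min ρ₁ ρ₂), by positivity, fun t ht q hq => ?_⟩
    have hmem : ∀ x : κ, g (fun i => t i.castSucc (e x i.castSucc)) ∈ Metric.ball (g 0) ρ := by
      intro x
      apply hball
      rw [mem_ball_zero_iff, pi_norm_lt_iff hρ₂]
      exact fun i => (ht _ _).trans_le ((min_le_right _ _).trans (min_le_right _ _))
    set s : Lb → ℝ := t (Fin.last d) with hs
    set c : ℝ → κ × (σ ⊕ τ) → ℝ := fun θ v =>
      Φ (g (fun i => t i.castSucc (e v.1 i.castSucc))) (θ * s (e v.1 (Fin.last d))) v.2 with hc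
    have key := aeval_eq_zero_of_iterate_mkDerivation
      (fun v : κ × (σ ⊕ τ) => s (e v.1 (Fin.last d)) • rename (fun i => (v.1, i)) (P v.2))
      (c := c) ?_ (rename (fun v => (v.1, Sum.inl v.2)) q) ?_ 1 ⟨zero_le_one, le_rfl⟩
    · rw [aeval_rename] at key
      rw [← key]
      congr 2
      funext v
      simp [hc, pr, ini, las, hs]
    · rintro θ ⟨hθ0, hθ1⟩ v
      have hlt : |θ * s (e v.1 (Fin.last d))| < ρ := by
        rw [abs_mul, abs_of_nonneg hθ0]
        refine (mul_le_of_le_one_left (abs_nonneg _) hθ1).trans_lt ?_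
        exact (ht _ _).trans_le (min_le_left _ _)
      have hd := hasDerivAt_pi.1 ((hΦ _ (hmem v.1)).2 _ hlt) v.2
      have hm : HasDerivAt (fun θ : ℝ => θ * s (e v.1 (Fin.last d))) (s (e v.1 (Fin.last d))) θ := by
        simpa using (hasDerivAt_id θ).mul_const (s (e v.1 (Fin.last d)))
      refine (HasDerivAt.comp θ hd hm).congr_deriv ?_
      rw [map_smul, aeval_rename, smul_eq_mul, mul_comm]
      rfl
    · intro k
      have := hrel (fun i => t i.castSucc)
        (fun i l => (ht _ _).trans_le ((min_le_right _ _).trans (min_le_left _ _))) _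
        ⟨s, k, q, hq, rfl⟩
      have hc0 : c 0 = fun v => g (fun i => t i.castSucc (e v.1 i.castSucc)) v.2 := by
        funext v
        simp only [hc, zero_mul]
        rw [(hΦ _ (hmem v.1)).1]
      rw [hc0]
      exact this

theorem exists_isSmoothModel {κ Lb : Type} [Fintype κ] [Fintype Lb] (d : ℕ) :
    ∀ {σ : Type} [Fintype σ] (e : κ → Fin d → Lb) (S : Set (MvPolynomial (κ × σ) ℝ))
      (r : MvPolynomial σ ℝ) (J : Set σ),
      (∀ M : ℕ, ∃ f : (Fin d → Fin M) → σ → ℝ, IsGoodMap e S r J f) →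
        ∃ g g', IsSmoothModel e S r J g g' := by
  induction d with
  | zero =>
    intro σ _ e S r J H
    obtain ⟨f, hf⟩ := H 0
    refine ⟨fun _ => f finZeroElim, 0, hasStrictFDerivAt_const _ _, hf.ne_zero _,
      fun i => i.elim0, 1, one_pos, fun _ _ q hq => ?_⟩
    rw [← hf.rel finZeroElim (fun i => i.elim0) q hq]
    congr 2
    funext v
    exact congrArg (fun a => f a v.2) (Subsingleton.elim _ _)
  | succ d ih =>
    intro σ _ e S r J H
    obtain ⟨m, P, j₀, hj₀, hf⟩ := exists_isGoodMap_flowRelations H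
    obtain ⟨g, g', hg⟩ := ih _ _ _ _ hf
    exact hg.of_flowRelations hj₀

end Models

/-- For an algebraic `k`-hypergraph `H` and a `d`-dimensional `k`-template `P`, the
following are equivalent: (1) `L(M^d,P)` is embeddable into `H` for every `M < ω`;
(2) `L(ℝ^d,P)` is embeddable into `H`; (3) `L(ℝ^d,P)` is immersible into `H`. -/
theorem embeddable_iff_immersible {α : Type*} (k n d : ℕ)
    (p : MvPolynomial (Fin k × Fin n) ℝ) (P : Finset (Fin d → α)) (hP : P.card = k) :
    ((∀ M : ℕ, Embeddable (LEdges k P (Fin M)) (zeroEdges k n p)) ↔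
        Embeddable (LEdges k P ℝ) (zeroEdges k n p)) ∧
    (Embeddable (LEdges k P ℝ) (zeroEdges k n p) ↔
        ∃ f : (Fin d → ℝ) → (Fin n → ℝ), IsImmersion k P (zeroEdges k n p) f) :=
  embeddable_iff_immersible_of_smoothModel k n d
    (fun e S r J => exists_isSmoothModel d e S r J) p P hP
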